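/- arXiv:2310.18971 — 2 statements merged into one kernel-verified Lean document; each statement's English description precedes it below -/
import Mathlib

section
/- Let f : G → G be a graph map. If cl(R(f)) = G and P(f) ≠ ∅, then cl(P(f)) = G. -/
open Set Function Filter Topology Metric

noncomputable section

/-- An open arc: a subspace homeomorphic to the open interval `(0,1)`. -/
def IsOpenArc {G : Type*} [TopologicalSpace G] (A : Set G) : Prop :=
  Nonempty (A ≃ₜ Set.Ioo (0 : ℝ) 1)

/-- A circle: a subspace homeomorphic to the unit circle. -/
def IsCircle {G : Type*} [TopologicalSpace G] (C : Set G) : Prop :=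
  Nonempty (C ≃ₜ Metric.sphere (0 : ℂ) 1)

/-- A (topological) graph: a non-degenerate compact connected metric space with a finite
vertex set `V` such that every connected component of the complement of `V` is an open arc,
and every circle contains at least three vertices. -/
structure IsTopGraph {G : Type*} [MetricSpace G] (V : Set G) : Prop where
  nontrivial : Nontrivial G
  compact : CompactSpace G
  connected : ConnectedSpace G
  finite_vertexSet : V.Finite
  component_openArc : ∀ x ∈ Vᶜ, IsOpenArc (connectedComponentIn Vᶜ x)
  circle_vertices : ∀ C : Set G, IsCircle C → 3 ≤ (C ∩ V).ncard

/-- The set of eventually periodic points: points with finite orbit. -/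
def evPeriodicPts {G : Type*} (f : G → G) : Set G :=
  {x | (Set.range fun n : ℕ => f^[n] x).Finite}

/-- `EP_n(f)`: points whose orbit contains at most `n` points. -/
def evPeriodicPtsLe {G : Type*} (f : G → G) (n : ℕ) : Set G :=
  {x | (Set.range fun i : ℕ => f^[i] x).encard ≤ n}

/-- The ω-limit set of a point `x` under `f`. -/
def omegaSet {G : Type*} [TopologicalSpace G] (f : G → G) (x : G) : Set G :=
  ⋂ i : ℕ, closure (Set.range fun n : ℕ => f^[n + i] x)

/-- The ω-limit set of `f`. -/
def omegaLimitSet {G : Type*} [TopologicalSpace G] (f : G → G) : Set G :=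
  ⋃ x : G, omegaSet f x

/-- The set of recurrent points of `f`. -/
def recurrentPts {G : Type*} [TopologicalSpace G] (f : G → G) : Set G :=
  {x | x ∈ omegaSet f x}

/-- The set of non-wandering points of `f`. -/
def nonwanderingPts {G : Type*} [TopologicalSpace G] (f : G → G) : Set G :=
  {x | ∀ U : Set G, IsOpen U → x ∈ U → ∃ n : ℕ, 0 < n ∧ (f^[n] '' U ∩ U).Nonempty}

/-- The set of almost periodic points of `f`. -/
def almostPeriodicPts {G : Type*} [TopologicalSpace G] (f : G → G) : Set G :=
  {x | ∀ U : Set G, IsOpen U → x ∈ U →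
    ∃ m : ℕ, 0 < m ∧ ∀ n : ℕ, ∃ i : ℕ, 1 ≤ i ∧ i ≤ m ∧ f^[n + i] x ∈ U}

/-- The ω-limit set of `x` under the restriction `f|K` (closures taken in the subspace `K`). -/
def omegaSetIn {G : Type*} [TopologicalSpace G] (f : G → G) (K : Set G) (x : G) : Set G :=
  ⋂ i : ℕ, (closure (Set.range fun n : ℕ => f^[n + i] x) ∩ K)

/-- The ω-limit set `ω(f|K)` of the restriction of `f` to `K`. -/
def omegaLimitSetIn {G : Type*} [TopologicalSpace G] (f : G → G) (K : Set G) : Set G :=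
  ⋃ x ∈ K, omegaSetIn f K x

/-- The non-wandering set `Ω(f|K)` of the restriction of `f` to `K`. -/
def nonwanderingPtsIn {G : Type*} [TopologicalSpace G] (f : G → G) (K : Set G) : Set G :=
  {x | x ∈ K ∧ ∀ U : Set G, IsOpen U → x ∈ U →
    ∃ n : ℕ, 0 < n ∧ (f^[n] '' (U ∩ K) ∩ (U ∩ K)).Nonempty}

/-- The almost periodic set `AP(f|K)` of the restriction of `f` to `K`. -/
def almostPeriodicPtsIn {G : Type*} [TopologicalSpace G] (f : G → G) (K : Set G) : Set G :=
  {x | x ∈ K ∧ ∀ U : Set G, IsOpen U → x ∈ U →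
    ∃ m : ℕ, 0 < m ∧ ∀ n : ℕ, ∃ i : ℕ, 1 ≤ i ∧ i ≤ m ∧ f^[n + i] x ∈ U}

/-- The orbit `O(K,f)` of a set `K` under `f`. -/
def setOrbit {G : Type*} (f : G → G) (K : Set G) : Set G := ⋃ i : ℕ, f^[i] '' K

/-- The orbit segment `O_n(K,f)`. -/
def setOrbitSeg {G : Type*} (f : G → G) (K : Set G) (n : ℕ) : Set G :=
  ⋃ i ≤ n, f^[i] '' K

/-- The inverse orbit (absorbed set) `O₋(K,f)`. -/
def invOrbit {G : Type*} (f : G → G) (K : Set G) : Set G := ⋃ i : ℕ, f^[i] ⁻¹' K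

/-- The main absorbed set `Ab(K,f)`: the union of the connected components of `O₋(K,f)`
that meet `K`. -/
def mainAbsorbed {G : Type*} [TopologicalSpace G] (f : G → G) (K : Set G) : Set G :=
  ⋃ x ∈ K, connectedComponentIn (invOrbit f K) x

/-- A minimal set of `f`: nonempty, closed, invariant, with no proper such subset. -/
def IsMinimalSet {G : Type*} [TopologicalSpace G] (f : G → G) (M : Set G) : Prop :=
  M.Nonempty ∧ IsClosed M ∧ f '' M ⊆ M ∧
    ∀ N : Set G, N ⊆ M → N.Nonempty → IsClosed N → f '' N ⊆ N → N = M

open Classical in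
/-- The valence of a point `x` in a metric space: the limit, as `r → 0⁺`, of the number of
boundary points of the ball `B(x,r)` (defined as the eventual value, if it exists). -/
def valence {G : Type*} [MetricSpace G] (x : G) : ℕ :=
  if h : ∃ n : ℕ, ∀ᶠ r in nhdsWithin (0 : ℝ) (Set.Ioi 0),
      (frontier (Metric.ball x r)).ncard = n
  then h.choose else 0

/-- The set of branching points. -/
def branchPts (G : Type*) [MetricSpace G] : Set G := {x | 2 < valence x}

/-- The total branching number `ξ(U)` of a subset `U` of `G`. -/
def totalBranch {G : Type*} [MetricSpace G] (U : Set G) : ℕ :=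
  ∑ᶠ v ∈ U ∩ branchPts G, (valence v - 2)

/-- Cyclic successor on `Fin k`. -/
def finSucc {k : ℕ} (i : Fin k) : Fin k := ⟨(i.1 + 1) % k, Nat.mod_lt _ i.pos⟩

/-- `C : Fin k → Set G` enumerates the connected components of `X`, and `f` maps each
component into the (cyclically) next one. -/
def IsCyclicDecomp {G : Type*} [TopologicalSpace G] (f : G → G) (X : Set G)
    {k : ℕ} (C : Fin k → Set G) : Prop :=
  (⋃ i, C i) = X ∧ (∀ i, (C i).Nonempty) ∧
  (∀ i, ∀ x ∈ C i, connectedComponentIn X x = C i) ∧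
  Function.Injective C ∧ ∀ i, f '' C i ⊆ C (finSucc i)

/-- A component-cyclic `f`-invariant set. -/
def ComponentCyclic {G : Type*} [TopologicalSpace G] (f : G → G) (X : Set G) : Prop :=
  ∃ (k : ℕ) (C : Fin k → Set G), 0 < k ∧ IsCyclicDecomp f X C

/-- `A` is a connected component of `S`. -/
def IsCompOf {G : Type*} [TopologicalSpace G] (A S : Set G) : Prop :=
  ∃ x ∈ S, connectedComponentIn S x = A

/-- The distance between two sets. -/
def setDist {G : Type*} [MetricSpace G] (A B : Set G) : ℝ :=
  sInf {r : ℝ | ∃ a ∈ A, ∃ b ∈ B, dist a b = r}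

end

section Dynamics

variable {G : Type*} [TopologicalSpace G] {f : G → G} {e : ℝ → G}

lemma exists_iterate_mem_of_recurrent {x : G} (hx : x ∈ recurrentPts f) {U : Set G}
    (hU : IsOpen U) (hxU : x ∈ U) (N : ℕ) : ∃ n, N ≤ n ∧ f^[n] x ∈ U := by
  have h : x ∈ closure (range fun n : ℕ => f^[n + N] x) := mem_iInter.1 hx N
  obtain ⟨_, hy, n, rfl⟩ := _root_.mem_closure_iff.1 h U hU hxU
  exact ⟨n + N, Nat.le_add_left _ _, hy⟩

lemma exists_iterate_notMem_of_not_recurrent {x : G} (hx : x ∉ recurrentPts f) :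
    ∃ U : Set G, IsOpen U ∧ x ∈ U ∧ ∃ N, ∀ n, N ≤ n → f^[n] x ∉ U := by
  obtain ⟨N, hN⟩ : ∃ N : ℕ, x ∉ closure (range fun n : ℕ => f^[n + N] x) := by
    by_contra! h
    exact hx (mem_iInter.2 h)
  rw [_root_.mem_closure_iff] at hN
  push Not at hN
  obtain ⟨U, hU, hxU, h⟩ := hN
  refine ⟨U, hU, hxU, N, fun n hn hm => ?_⟩
  have : f^[n] x ∈ U ∩ range fun n : ℕ => f^[n + N] x :=
    ⟨hm, n - N, by simp only [Nat.sub_add_cancel hn]⟩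
  rw [h] at this
  exact this

lemma mem_periodicPts_of_recurrent [T1Space G] {x : G} (hx : x ∈ recurrentPts f) {n : ℕ}
    (hn : f^[n] x ∈ periodicPts f) : x ∈ periodicPts f := by
  have hfin : (range fun k : ℕ => f^[k] (f^[n] x)).Finite := by
    refine ((Finset.range (minimalPeriod f (f^[n] x))).finite_toSet.image
      fun k => f^[k] (f^[n] x)).subset ?_
    rintro _ ⟨k, rfl⟩
    exact ⟨k % minimalPeriod f (f^[n] x),
      by simpa using Nat.mod_lt _ (minimalPeriod_pos_of_mem_periodicPts hn),
      iterate_mod_minimalPeriod_eq⟩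
  have h : x ∈ range fun k : ℕ => f^[k] (f^[n] x) := by
    by_contra hcon
    obtain ⟨m, hm, hmem⟩ := exists_iterate_mem_of_recurrent hx hfin.isClosed.isOpen_compl hcon n
    refine hmem ⟨m - n, ?_⟩
    simp only [← iterate_add_apply, Nat.sub_add_cancel hm]
  obtain ⟨k, hk⟩ := h
  obtain ⟨p, hp, hper⟩ := hn
  exact ⟨p, hp, by simpa only [hk] using hper.apply_iterate k⟩

/-- An arc without fixed points of `F`, `H` and `H ∘ F`, one of whose points `z` is sent outside
the arc by `H`: if `F` moves `x` towards `z`, then `H` cannot move it back partially. -/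
lemma not_partial_return [T2Space G] (he : IsOpenEmbedding e) {F H : G → G} (hF : Continuous F)
    (hH : Continuous H) {l r x z x₁ x₂ : ℝ} (hlx : l < x) (hzr : z < r)
    (hx₁ : F (e x) = e x₁) (hx₂ : H (e x₁) = e x₂) (h₁ : x < x₂) (h₂ : x₂ < x₁) (h₃ : x₁ < z)
    (hfix : ∀ s ∈ Ioo l r, H (e s) ≠ e s ∧ H (F (e s)) ≠ e s)
    (hHz : H (e z) ∉ e '' Ioo l r) : False := by
  set A : Set ℝ := {s | ∃ p q, s < p ∧ F (e s) ∈ e '' Ioo q z ∧ H (F (e s)) ∈ e '' Ioo p q}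
    with hA
  set B : Set ℝ := {s | ∃ c w, (x ≤ s ∧ s ≤ c ∧ c ≤ w ∧ w ≤ z) ∧ F (e s) = e w ∧ H (e w) = e c}
    with hB
  have hAo : IsOpen A := by
    have : A = ⋃ p, ⋃ q, Iio p ∩ ((fun s => F (e s)) ⁻¹' (e '' Ioo q z) ∩
        (fun s => H (F (e s))) ⁻¹' (e '' Ioo p q)) := by
      ext s; simp [hA]
    rw [this]
    have hFe : Continuous fun s => F (e s) := hF.comp he.continuous
    exact isOpen_iUnion fun p => isOpen_iUnion fun q => isOpen_Iio.inter
      (((he.isOpenMap _ isOpen_Ioo).preimage hFe).inter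
        ((he.isOpenMap _ isOpen_Ioo).preimage (hH.comp hFe)))
  have hBc : IsClosed B := by
    have hK : IsCompact {t : ℝ × ℝ × ℝ | (x ≤ t.1 ∧ t.1 ≤ t.2.1 ∧ t.2.1 ≤ t.2.2 ∧ t.2.2 ≤ z) ∧
        F (e t.1) = e t.2.2 ∧ H (e t.2.2) = e t.2.1} := by
      refine IsCompact.of_isClosed_subset
        ((isCompact_Icc (a := x) (b := z)).prod
          ((isCompact_Icc (a := x) (b := z)).prod (isCompact_Icc (a := x) (b := z)))) ?_ ?_
      · have hec := he.continuous
        refine IsClosed.inter ?_ ?_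
        · have h2 : Continuous fun t : ℝ × ℝ × ℝ => t.2.1 := by fun_prop
          have h3 : Continuous fun t : ℝ × ℝ × ℝ => t.2.2 := by fun_prop
          exact (isClosed_le continuous_const continuous_fst).inter
            ((isClosed_le continuous_fst h2).inter
              ((isClosed_le h2 h3).inter (isClosed_le h3 continuous_const)))
        · exact (isClosed_eq (f := fun t : ℝ × ℝ × ℝ => F (e t.1)) (by fun_prop)
            (g := fun t : ℝ × ℝ × ℝ => e t.2.2) (by fun_prop)).inter
              (isClosed_eq (f := fun t : ℝ × ℝ × ℝ => H (e t.2.2)) (by fun_prop)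
                (g := fun t : ℝ × ℝ × ℝ => e t.2.1) (by fun_prop))
      · rintro ⟨s, c, w⟩ ⟨⟨h1, h2, h3, h4⟩, -⟩
        simp only at h1 h2 h3 h4
        refine ⟨⟨h1, ?_⟩, ⟨?_, ?_⟩, ?_, ?_⟩ <;> simp only <;> linarith
    convert (hK.image continuous_fst).isClosed using 1
    ext s
    constructor
    · rintro ⟨c, w, h⟩
      exact ⟨(s, c, w), h, rfl⟩
    · rintro ⟨⟨s, c, w⟩, h, rfl⟩
      exact ⟨c, w, h⟩
  have hAB : ∀ s ∈ Icc x z, s ∈ A → s ∈ B := by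
    rintro s hs ⟨p, q, hsp, ⟨w, hw, hFw⟩, ⟨c, hc, hHc⟩⟩
    exact ⟨c, w, ⟨hs.1, (hsp.trans hc.1).le, (hc.2.trans hw.1).le, hw.2.le⟩, hFw.symm,
      by rw [hHc, hFw]⟩
  have hBA : ∀ s ∈ B, s ∈ A := by
    rintro s ⟨c, w, ⟨h1, h2, h3, h4⟩, hFw, hHc⟩
    have hs : s ∈ Ioo l r := ⟨by linarith, by linarith⟩
    have hw : w ∈ Ioo l r := ⟨by linarith, by linarith⟩
    have hsc : s < c := lt_of_le_of_ne h2 fun h => (hfix s hs).2 (by rw [hFw, hHc, h])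
    have hcw : c < w := lt_of_le_of_ne h3 fun h => (hfix w hw).1 (by rw [hHc, h])
    have hwz : w < z := lt_of_le_of_ne h4 fun h =>
      hHz (by rw [← h, hHc]; exact ⟨c, ⟨by linarith, by linarith⟩, rfl⟩)
    obtain ⟨p, hp⟩ := exists_between hsc
    obtain ⟨q, hq⟩ := exists_between hcw
    exact ⟨p, q, hp.1, ⟨w, ⟨hq.2, hwz⟩, hFw.symm⟩, ⟨c, ⟨hp.2, hq.1⟩, by rw [hFw, hHc]⟩⟩
  have hxz : x ≤ z := by linarith
  have hxA : x ∈ A := hBA x ⟨x₂, x₁, ⟨le_rfl, h₁.le, h₂.le, h₃.le⟩, hx₁, hx₂⟩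
  have hzA : z ∉ A := by
    rintro ⟨p, q, hzp, ⟨w, hw, -⟩, c, hc, -⟩
    linarith [hw.1, hw.2, hc.1, hc.2]
  obtain ⟨s, hs, hsA, hsB⟩ := isPreconnected_Icc (a := x) (b := z) A Bᶜ hAo hBc.isOpen_compl
    (fun s _ => by
      by_cases h : s ∈ B
      · exact Or.inl (hBA s h)
      · exact Or.inr h)
    ⟨x, ⟨le_rfl, hxz⟩, hxA⟩ ⟨z, ⟨hxz, le_rfl⟩, fun h => hzA (hBA z h)⟩
  exact hsB (hAB s hs hsA)

lemma eventually_notMem_right [T2Space G] (hf : Continuous f) (he : IsOpenEmbedding e)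
    {l r x z : ℝ} (hJ : ∀ s ∈ Ioo l r, e s ∉ periodicPts f) (hlx : l < x) (hxz : x < z)
    (hzr : z < r) {N : ℕ} (hz : ∀ n, N ≤ n → f^[n] (e z) ∉ e '' Ioo l r) :
    ∃ y, x < y ∧ ∃ M, ∀ n, M ≤ n → f^[n] (e x) ∉ e '' Ioo x y := by
  by_cases h : ∃ m, N + 1 ≤ m ∧ f^[m] (e x) ∈ e '' Ioo x z
  · obtain ⟨m, hm, x₁, hx₁, hmx⟩ := h
    refine ⟨x₁, hx₁.1, m + (N + 1), ?_⟩
    rintro n hn ⟨x₂, hx₂, hnx⟩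
    obtain ⟨k, rfl⟩ := Nat.exists_eq_add_of_le (show m ≤ n by omega)
    have hper : ∀ s ∈ Ioo l r, ∀ j, 0 < j → f^[j] (e s) ≠ e s :=
      fun s hs j hj h => hJ s hs ⟨j, hj, h⟩
    refine not_partial_return he (hf.iterate m) (hf.iterate k) hlx hzr hmx.symm ?_ hx₂.1 hx₂.2
      hx₁.2 (fun s hs => ⟨hper s hs k (by omega), ?_⟩) (hz k (by omega))
    · rw [hmx, hnx, ← iterate_add_apply, Nat.add_comm k m]
    · rw [← iterate_add_apply]
      exact hper s hs _ (by omega)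
  · push Not at h
    exact ⟨z, hxz, N + 1, h⟩

lemma image_comp_neg_Ioo {X : Type*} (e : ℝ → X) (a b : ℝ) :
    (fun s => e (-s)) '' Ioo (-b) (-a) = e '' Ioo a b := by
  rw [show (fun s => e (-s)) = e ∘ Neg.neg from rfl, image_comp]
  simp

lemma isOpenEmbedding_comp_neg (he : IsOpenEmbedding e) :
    IsOpenEmbedding fun s => e (-s) :=
  he.comp (Homeomorph.neg ℝ).isOpenEmbedding

lemma eventually_notMem_left [T2Space G] (hf : Continuous f) (he : IsOpenEmbedding e)
    {l r x z : ℝ} (hJ : ∀ s ∈ Ioo l r, e s ∉ periodicPts f) (hlz : l < z) (hzx : z < x)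
    (hxr : x < r) {N : ℕ} (hz : ∀ n, N ≤ n → f^[n] (e z) ∉ e '' Ioo l r) :
    ∃ y, y < x ∧ ∃ M, ∀ n, M ≤ n → f^[n] (e x) ∉ e '' Ioo y x := by
  obtain ⟨y, hy, M, hM⟩ := eventually_notMem_right (l := -r) (r := -l) (x := -x) (z := -z)
    (N := N) hf (isOpenEmbedding_comp_neg he)
    (fun s hs => hJ (-s) ⟨by linarith [hs.2], by linarith [hs.1]⟩) (by linarith) (by linarith)
    (by linarith) (by simpa only [image_comp_neg_Ioo, neg_neg] using hz)
  refine ⟨-y, by linarith, M, fun n hn => ?_⟩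
  have := hM n hn
  rwa [← neg_neg y, image_comp_neg_Ioo, neg_neg x] at this

/-- An open arc without periodic points in which recurrent points are dense contains an open
subarc of recurrent points. -/
lemma exists_Ioo_recurrent [T2Space G] (hf : Continuous f) (he : IsOpenEmbedding e)
    (hR : Dense (recurrentPts f)) {l r : ℝ} (hlr : l < r)
    (hJ : ∀ s ∈ Ioo l r, e s ∉ periodicPts f) :
    ∃ l' r', l ≤ l' ∧ l' < r' ∧ r' ≤ r ∧ ∀ s ∈ Ioo l' r', e s ∈ recurrentPts f := by
  have hleave : ∀ z ∈ Ioo l r, e z ∉ recurrentPts f → ∃ a b, l ≤ a ∧ a < z ∧ z < b ∧ b ≤ r ∧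
      ∃ N, ∀ n, N ≤ n → f^[n] (e z) ∉ e '' Ioo a b := by
    intro z hz hzR
    obtain ⟨U, hU, hzU, N, hN⟩ := exists_iterate_notMem_of_not_recurrent hzR
    have hnhds : e ⁻¹' U ∩ Ioo l r ∈ 𝓝 z :=
      inter_mem ((hU.preimage he.continuous).mem_nhds hzU) (Ioo_mem_nhds hz.1 hz.2)
    obtain ⟨a, b, hab, hsub⟩ := mem_nhds_iff_exists_Ioo_subset.1 hnhds
    have hI : Ioo a b ⊆ Ioo l r := hsub.trans inter_subset_right
    obtain ⟨h1, h2⟩ := (Ioo_subset_Ioo_iff (hab.1.trans hab.2)).1 hI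
    refine ⟨a, b, h1, hab.1, hab.2, h2, N, fun n hn => ?_⟩
    rintro ⟨s, hs, hse⟩
    exact hN n hn (hse ▸ (hsub hs).1)
  by_cases hall : ∀ s ∈ Ioo l r, e s ∈ recurrentPts f
  · exact ⟨l, r, le_rfl, hlr, le_rfl, hall⟩
  push Not at hall
  obtain ⟨z₀, hz₀, hz₀R⟩ := hall
  obtain ⟨a₀, b₀, hla₀, ha₀, hb₀, hbr₀, N₀, hN₀⟩ := hleave z₀ hz₀ hz₀R
  refine ⟨z₀, b₀, hz₀.1.le, hb₀, hbr₀, fun z₁ hz₁ => ?_⟩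
  by_contra hz₁R
  obtain ⟨a₁, b₁, hla₁, ha₁, hb₁, hbr₁, N₁, hN₁⟩ :=
    hleave z₁ ⟨hz₀.1.trans hz₁.1, hz₁.2.trans_le hbr₀⟩ hz₁R
  obtain ⟨_, hxR, x, hx, rfl⟩ := hR.exists_mem_open
    (he.isOpenMap _ (isOpen_Ioo (a := max z₀ a₁) (b := z₁)))
    ((nonempty_Ioo.2 (max_lt hz₁.1 ha₁)).image e)
  have hx₀ : z₀ < x := (le_max_left _ _).trans_lt hx.1
  have hx₁ : a₁ < x := (le_max_right _ _).trans_lt hx.1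
  obtain ⟨y, hy, M, hM⟩ := eventually_notMem_left hf he
    (fun s hs => hJ s ⟨hla₀.trans_lt hs.1, hs.2.trans_le hbr₀⟩) ha₀ hx₀ (hx.2.trans hz₁.2) hN₀
  obtain ⟨y', hy', M', hM'⟩ := eventually_notMem_right hf he
    (fun s hs => hJ s ⟨hla₁.trans_lt hs.1, hs.2.trans_le hbr₁⟩) hx₁ hx.2 hb₁ hN₁
  obtain ⟨n, hn, s, hs, hse⟩ := exists_iterate_mem_of_recurrent hxR
    (he.isOpenMap _ (isOpen_Ioo (a := y) (b := y'))) ⟨x, ⟨hy, hy'⟩, rfl⟩ (M + M' + 1)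
  rcases lt_trichotomy s x with h | rfl | h
  · exact hM n (by omega) ⟨s, ⟨hs.1, h⟩, hse⟩
  · exact hJ s ⟨hz₀.1.trans hx₀, hx.2.trans (hz₁.2.trans_le hbr₀)⟩ ⟨n, by omega, hse.symm⟩
  · exact hM' n (by omega) ⟨s, ⟨h, hs.2⟩, hse⟩

lemma exists_left_endpoint (he : IsOpenEmbedding e) {l r c d : ℝ}
    (hJ : ∀ s ∈ Ioo l r, e s ∉ periodicPts f) (hR : ∀ s ∈ Ioo l r, e s ∈ recurrentPts f)
    (hlc : l < c) (hcd : c < d) (hdr : d < r) :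
    ∃ a, l < a ∧ a ≤ c ∧ ∃ n, 0 < n ∧ f^[n] (e a) ∈ e '' Ioo a d := by
  have hc : c ∈ Ioo l r := ⟨hlc, hcd.trans hdr⟩
  obtain ⟨n, hn, a, ha, hna⟩ := exists_iterate_mem_of_recurrent (hR c hc)
    (he.isOpenMap _ (isOpen_Ioo (a := l) (b := d))) ⟨c, ⟨hlc, hcd⟩, rfl⟩ 1
  rcases lt_trichotomy a c with h | rfl | h
  · obtain ⟨m, hm, s, hs, hms⟩ := exists_iterate_mem_of_recurrent (hR c hc)
      (he.isOpenMap _ (isOpen_Ioo (a := a) (b := d))) ⟨c, ⟨h, hcd⟩, rfl⟩ (n + 1)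
    refine ⟨a, ha.1, h.le, m - n, by omega, s, hs, ?_⟩
    rw [hms, hna, ← iterate_add_apply, Nat.sub_add_cancel (by omega)]
  · exact absurd ⟨n, hn, hna.symm⟩ (hJ a hc)
  · exact ⟨c, hlc, le_rfl, n, hn, a, ⟨h, ha.2⟩, hna⟩

lemma exists_right_endpoint (he : IsOpenEmbedding e) {l r c d : ℝ}
    (hJ : ∀ s ∈ Ioo l r, e s ∉ periodicPts f) (hR : ∀ s ∈ Ioo l r, e s ∈ recurrentPts f)
    (hlc : l < c) (hcd : c < d) (hdr : d < r) :
    ∃ b, d ≤ b ∧ b < r ∧ ∃ n, 0 < n ∧ f^[n] (e b) ∈ e '' Ioo c b := by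
  obtain ⟨a, h1, h2, n, hn, h⟩ := exists_left_endpoint (f := f) (l := -r) (r := -l) (c := -d)
    (d := -c) (isOpenEmbedding_comp_neg he)
    (fun s hs => hJ (-s) ⟨by linarith [hs.2], by linarith [hs.1]⟩)
    (fun s hs => hR (-s) ⟨by linarith [hs.2], by linarith [hs.1]⟩) (by linarith) (by linarith)
    (by linarith)
  refine ⟨-a, by linarith, by linarith, n, hn, ?_⟩
  rwa [← neg_neg a, image_comp_neg_Ioo, neg_neg a] at h

lemma exists_Icc_returning (he : IsOpenEmbedding e) {l r : ℝ} (hlr : l < r)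
    (hJ : ∀ s ∈ Ioo l r, e s ∉ periodicPts f) (hR : ∀ s ∈ Ioo l r, e s ∈ recurrentPts f) :
    ∃ a b, l < a ∧ a < b ∧ b < r ∧
      ∀ s ∈ Icc a b, ∃ n, 0 < n ∧ f^[n] (e s) ∈ e '' Ioo a b := by
  obtain ⟨c, hlc, hcr⟩ := exists_between hlr
  obtain ⟨d, hcd, hdr⟩ := exists_between hcr
  obtain ⟨a, hla, hac, n, hn, ha⟩ := exists_left_endpoint he hJ hR hlc hcd hdr
  obtain ⟨b, hdb, hbr, m, hm, hb⟩ := exists_right_endpoint he hJ hR hlc hcd hdr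
  refine ⟨a, b, hla, by linarith, hbr, fun s hs => ?_⟩
  rcases hs.1.eq_or_lt with rfl | has
  · exact ⟨n, hn, image_mono (Ioo_subset_Ioo_right hdb) ha⟩
  rcases hs.2.eq_or_lt with rfl | hsb
  · exact ⟨m, hm, image_mono (Ioo_subset_Ioo_left hac) hb⟩
  exact exists_iterate_mem_of_recurrent (hR s ⟨by linarith, by linarith⟩)
    (he.isOpenMap _ isOpen_Ioo) ⟨s, ⟨has, hsb⟩, rfl⟩ 1

/-- If each point of a compact set `K` returns to an open subset of `K`, then a finite segment of
the orbit of `K` is forward invariant. -/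
lemma exists_invariant_orbit_segment (hf : Continuous f) {K O : Set G} (hK : IsCompact K)
    (hO : IsOpen O) (hOK : O ⊆ K) (hret : ∀ y ∈ K, ∃ n, 0 < n ∧ f^[n] y ∈ O) :
    ∃ M : ℕ, 0 < M ∧ MapsTo f (⋃ i ∈ Finset.range M, f^[i] '' K)
      (⋃ i ∈ Finset.range M, f^[i] '' K) := by
  obtain ⟨t, ht⟩ := hK.elim_finite_subcover (fun n : ℕ => f^[n + 1] ⁻¹' O)
    (fun n => hO.preimage (hf.iterate _)) fun y hy => by
      obtain ⟨n, hn, h⟩ := hret y hy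
      exact mem_iUnion.2 ⟨n - 1, by rwa [mem_preimage, Nat.sub_add_cancel hn]⟩
  refine ⟨t.sup id + 1, Nat.succ_pos _, ?_⟩
  intro x hx
  simp only [Finset.mem_range, mem_iUnion, exists_prop] at hx ⊢
  obtain ⟨i, hi, y, hy, rfl⟩ := hx
  by_cases h : i < t.sup id
  · exact ⟨i + 1, by omega, y, hy, iterate_succ_apply' f i y⟩
  obtain ⟨k, hk, hky⟩ := mem_iUnion₂.1 (ht hy)
  have hkt : k ≤ t.sup id := Finset.le_sup (f := id) hk
  refine ⟨i - k, by omega, f^[k + 1] y, hOK hky, ?_⟩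
  rw [← iterate_add_apply, ← iterate_succ_apply' f i y]
  congr 2
  omega

lemma mapsTo_frontier_of_dense_recurrent (hf : Continuous f) (hR : Dense (recurrentPts f))
    {S : Set G} (hS : IsClosed S) (hfS : MapsTo f S S) : MapsTo f (frontier S) (frontier S) := by
  intro b hb
  rw [hS.frontier_eq] at hb
  have hfb : f b ∈ closure Sᶜ := by
    have hb' : b ∈ closure (Sᶜ ∩ recurrentPts f) :=
      closure_minimal (hR.open_subset_closure_inter hS.isOpen_compl) isClosed_closure
        (by rw [closure_compl]; exact hb.2)
    refine closure_mono ?_ (map_mem_closure hf hb' (mapsTo_image f _))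
    rintro _ ⟨y, ⟨hyS, hyR⟩, rfl⟩ hfy
    obtain ⟨n, hn, hny⟩ := exists_iterate_mem_of_recurrent hyR hS.isOpen_compl hyS 1
    obtain ⟨k, rfl⟩ := Nat.exists_eq_add_of_le' hn
    exact hny (by rw [iterate_succ_apply]; exact hfS.iterate k hfy)
  rw [hS.frontier_eq]
  rw [closure_compl] at hfb
  exact ⟨hfS hb.1, hfb⟩

lemma exists_periodicPt_of_finite {X : Type*} {f : X → X} {D : Set X} (hD : D.Finite)
    (hne : D.Nonempty) (hfD : MapsTo f D D) : ∃ x ∈ D, x ∈ periodicPts f := by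
  obtain ⟨b, hb⟩ := hne
  have := hD.to_subtype
  obtain ⟨i, j, hij, h⟩ :=
    Finite.exists_ne_map_eq_of_infinite fun n : ℕ => (⟨f^[n] b, hfD.iterate n hb⟩ : D)
  simp only [Subtype.mk.injEq] at h
  wlog hlt : i < j generalizing i j
  · exact this j i hij.symm h.symm (by omega)
  refine ⟨f^[i] b, hfD.iterate i hb, j - i, by omega, ?_⟩
  rw [IsPeriodicPt, IsFixedPt, ← iterate_add_apply, Nat.sub_add_cancel hlt.le, h]

end Dynamics

section Graph

variable {G : Type*} [TopologicalSpace G]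

lemma IsPreconnected.subset_image_Ioo [T2Space G] {e : ℝ → G} (he : IsOpenEmbedding e) {C : Set G}
    (hC : IsPreconnected C) {u t w : ℝ} (hut : u < t) (htw : t < w) (hu : e u ∉ C) (ht : e t ∈ C)
    (hw : e w ∉ C) : C ⊆ e '' Ioo u w := by
  refine IsPreconnected.subset_left_of_subset_union (he.isOpenMap _ isOpen_Ioo)
    (isCompact_Icc.image he.continuous).isClosed.isOpen_compl (v := (e '' Icc u w)ᶜ)
    (disjoint_compl_right.mono_left (image_mono Ioo_subset_Icc_self)) ?_
    ⟨e t, ht, t, ⟨hut, htw⟩, rfl⟩ hC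
  intro y hy
  by_cases h : y ∈ e '' Icc u w
  · obtain ⟨s, hs, rfl⟩ := h
    refine Or.inl ⟨s, ⟨lt_of_le_of_ne hs.1 ?_, lt_of_le_of_ne hs.2 ?_⟩, rfl⟩
    · rintro rfl
      exact hu hy
    · rintro rfl
      exact hw hy
  · exact Or.inr h

lemma IsPreconnected.finite_frontier_inter_range [T2Space G] {e : ℝ → G} (he : IsOpenEmbedding e)
    {C : Set G} (hC : IsPreconnected C) (hCc : IsClosed C) : (frontier C ∩ range e).Finite := by
  rw [← image_preimage_eq_inter_range]
  refine Set.Finite.image e ?_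
  by_contra hinf
  obtain ⟨t, ht, hcard⟩ := Set.Infinite.exists_subset_card_eq hinf 3
  have hmem : ∀ i, e (t.orderEmbOfFin hcard i) ∈ frontier C :=
    fun i => ht (t.orderEmbOfFin_mem hcard i)
  have h01 : t.orderEmbOfFin hcard 0 < t.orderEmbOfFin hcard 1 := by simp
  have h12 : t.orderEmbOfFin hcard 1 < t.orderEmbOfFin hcard 2 := by simp
  have h0 := hmem 0
  have h1 := hmem 1
  have h2 := hmem 2
  generalize t.orderEmbOfFin hcard 0 = b₀ at *
  generalize t.orderEmbOfFin hcard 1 = b₁ at *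
  generalize t.orderEmbOfFin hcard 2 = b₂ at *
  have hout : ∀ b, e b ∈ frontier C → ∀ I : Set ℝ, IsOpen I → b ∈ I → ∃ u ∈ I, e u ∉ C := by
    intro b hb I hI hbI
    rw [hCc.frontier_eq] at hb
    obtain ⟨-, hy⟩ := hb
    by_contra! h
    exact hy (interior_maximal (image_subset_iff.2 h) (he.isOpenMap _ hI) ⟨b, hbI, rfl⟩)
  obtain ⟨u₀, hu₀, hu₀C⟩ := hout b₀ h0 (Iio b₁) isOpen_Iio h01
  obtain ⟨u₁, hu₁, hu₁C⟩ := hout b₁ h1 (Ioo b₀ b₂) isOpen_Ioo ⟨h01, h12⟩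
  obtain ⟨u₂, hu₂, hu₂C⟩ := hout b₂ h2 (Ioi b₁) isOpen_Ioi h12
  have hsub : frontier C ⊆ C := hCc.frontier_subset
  rcases lt_trichotomy u₁ b₁ with h | rfl | h
  · obtain ⟨s, hs, hse⟩ := hC.subset_image_Ioo he h hu₂ hu₁C (hsub h1) hu₂C (hsub h0)
    rw [he.injective hse] at hs
    exact lt_asymm hs.1 hu₁.1
  · exact hu₁C (hsub h1)
  · obtain ⟨s, hs, hse⟩ := hC.subset_image_Ioo he hu₀ h hu₀C (hsub h1) hu₁C (hsub h2)
    rw [he.injective hse] at hs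
    exact lt_asymm hs.2 hu₁.2

lemma isCircle_insert_range [T2Space G] {γ : ℝ → G} (hγ : Continuous γ) (hinj : Injective γ)
    {u : G} (hu : u ∉ range γ) (htop : Tendsto γ atTop (𝓝 u)) (hbot : Tendsto γ atBot (𝓝 u)) :
    IsCircle (insert u (range γ)) := by
  let g : C(OnePoint ℝ, G) := OnePoint.continuousMapMk ⟨γ, hγ⟩ u (by
    rw [coclosedCompact_eq_cocompact, cocompact_eq_atBot_atTop]
    exact hbot.sup htop)
  have hginf : g OnePoint.infty = u := rfl
  have hgcoe : ∀ t : ℝ, g (t : OnePoint ℝ) = γ t := fun _ => rfl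
  have hginj : Injective g := by
    intro a b hab
    induction a using OnePoint.rec with
    | infty =>
      induction b using OnePoint.rec with
      | infty => rfl
      | coe t => exact (hu ⟨t, (hgcoe t).symm.trans (hab.symm.trans hginf)⟩).elim
    | coe s =>
      induction b using OnePoint.rec with
      | infty => exact (hu ⟨s, (hgcoe s).symm.trans (hab.trans hginf)⟩).elim
      | coe t => rw [hinj (show γ s = γ t from hab)]
  have hrange : range g = insert u (range γ) := by
    ext y
    constructor
    · rintro ⟨a, rfl⟩
      induction a using OnePoint.rec with
      | infty => exact Or.inl rfl
      | coe t => exact Or.inr ⟨t, rfl⟩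
    · rintro (h | ⟨t, rfl⟩)
      exacts [⟨OnePoint.infty, h.symm⟩, ⟨(t : OnePoint ℝ), rfl⟩]
  have hemb : IsEmbedding g := (g.continuous.isClosedEmbedding hginj).isEmbedding
  let φ : OnePoint ℝ ≃ₜ Metric.sphere (0 : ℂ) 1 :=
    (onePointEquivSphereOfFinrankEq (ι := Fin 2) (V := ℝ) (by simp)).trans
      (Complex.orthonormalBasisOneI.repr.toHomeomorph.subtype fun z => by simp).symm
  rw [← hrange]
  exact ⟨hemb.toHomeomorph.symm.trans φ⟩

/-- The concatenation of two arcs from `u` to `v`, with `v` at parameter `0`. -/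
noncomputable def joinArcs (e₁ e₂ : ℝ → G) (v : G) (t : ℝ) : G :=
  if t = 0 then v else if t < 0 then e₁ (-Real.log t) else e₂ (-Real.log t)

lemma isCircle_of_two_arcs [T2Space G] {e₁ e₂ : ℝ → G} (h₁ : Continuous e₁) (h₂ : Continuous e₂)
    (i₁ : Injective e₁) (i₂ : Injective e₂) (hd : Disjoint (range e₁) (range e₂)) {u v : G}
    (huv : u ≠ v) (hu₁ : u ∉ range e₁) (hu₂ : u ∉ range e₂) (hv₁ : v ∉ range e₁)
    (hv₂ : v ∉ range e₂) (b₁ : Tendsto e₁ atBot (𝓝 u)) (b₂ : Tendsto e₂ atBot (𝓝 u))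
    (t₁ : Tendsto e₁ atTop (𝓝 v)) (t₂ : Tendsto e₂ atTop (𝓝 v)) :
    IsCircle (insert u (range (joinArcs e₁ e₂ v))) := by
  have hzero : joinArcs e₁ e₂ v 0 = v := if_pos rfl
  have hneg : ∀ t < 0, joinArcs e₁ e₂ v t = e₁ (-Real.log t) := fun t ht => by
    rw [joinArcs, if_neg ht.ne, if_pos ht]
  have hpos : ∀ t, 0 < t → joinArcs e₁ e₂ v t = e₂ (-Real.log t) := fun t ht => by
    rw [joinArcs, if_neg ht.ne', if_neg ht.not_gt]
  have hlog : Tendsto (fun t : ℝ => -Real.log t) (𝓝[≠] 0) atTop :=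
    tendsto_neg_atBot_atTop.comp Real.tendsto_log_nhdsNE_zero
  have hdisj : ∀ s t, e₁ s ≠ e₂ t := fun s t h => disjoint_left.1 hd ⟨s, rfl⟩ ⟨t, h.symm⟩
  refine isCircle_insert_range ?_ ?_ ?_ ?_ ?_
  · rw [continuous_iff_continuousAt]
    intro t
    rcases lt_trichotomy t 0 with ht | rfl | ht
    · refine ContinuousAt.congr (f := fun t => e₁ (-Real.log t)) ?_ ?_
      · exact h₁.continuousAt.comp (Real.continuousAt_log ht.ne).neg
      · filter_upwards [Iio_mem_nhds ht] with s hs using (hneg s hs).symm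
    · rw [continuousAt_iff_punctured_nhds, hzero]
      intro O hO
      rw [mem_map]
      filter_upwards [(t₁.comp hlog) hO, (t₂.comp hlog) hO, self_mem_nhdsWithin] with s hs₁ hs₂ hs
      rcases lt_or_gt_of_ne hs with h | h
      · rw [mem_preimage, hneg s h]; exact hs₁
      · rw [mem_preimage, hpos s h]; exact hs₂
    · refine ContinuousAt.congr (f := fun t => e₂ (-Real.log t)) ?_ ?_
      · exact h₂.continuousAt.comp (Real.continuousAt_log ht.ne').neg
      · filter_upwards [Ioi_mem_nhds ht] with s hs using (hpos s hs).symm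
  · intro s t hst
    rcases lt_trichotomy s 0 with hs | rfl | hs <;> rcases lt_trichotomy t 0 with ht | rfl | ht
    · rw [hneg s hs, hneg t ht] at hst
      have := neg_injective (i₁ hst)
      rw [← Real.log_neg_eq_log, ← Real.log_neg_eq_log t] at this
      exact neg_injective (Real.log_injOn_pos (neg_pos.2 hs) (neg_pos.2 ht) this)
    · rw [hneg s hs, hzero] at hst
      exact absurd ⟨_, hst⟩ hv₁
    · rw [hneg s hs, hpos t ht] at hst
      exact absurd hst (hdisj _ _)
    · rw [hneg t ht, hzero] at hst
      exact absurd ⟨_, hst.symm⟩ hv₁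
    · rfl
    · rw [hpos t ht, hzero] at hst
      exact absurd ⟨_, hst.symm⟩ hv₂
    · rw [hneg t ht, hpos s hs] at hst
      exact absurd hst.symm (hdisj _ _)
    · rw [hpos s hs, hzero] at hst
      exact absurd ⟨_, hst⟩ hv₂
    · rw [hpos s hs, hpos t ht] at hst
      exact Real.log_injOn_pos hs ht (neg_injective (i₂ hst))
  · rintro ⟨t, ht⟩
    rcases lt_trichotomy t 0 with h | rfl | h
    · exact hu₁ ⟨_, (hneg t h).symm.trans ht⟩
    · exact huv (ht.symm.trans hzero)
    · exact hu₂ ⟨_, (hpos t h).symm.trans ht⟩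
  · refine (b₂.comp (tendsto_neg_atTop_atBot.comp Real.tendsto_log_atTop)).congr' ?_
    filter_upwards [eventually_gt_atTop 0] with s hs using (hpos s hs).symm
  · refine (b₁.comp (tendsto_neg_atTop_atBot.comp
      (Real.tendsto_log_atTop.comp tendsto_neg_atBot_atTop))).congr' ?_
    filter_upwards [eventually_lt_atBot 0] with s hs
    rw [hneg s hs]
    simp

/-- An end of an arc whose closure adds only finitely many points converges to one of these. -/
lemma exists_tendsto_atTop [T2Space G] [CompactSpace G] {V : Set G} (hV : V.Finite) {e : ℝ → G}
    (he : IsEmbedding e) (hcl : closure (range e) ⊆ range e ∪ V) :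
    ∃ v ∈ V, Tendsto e atTop (𝓝 v) := by
  have hclus : ∀ y, MapClusterPt y atTop e → y ∈ V := by
    intro y hy
    have hyc : y ∈ closure (range e) := by
      refine _root_.mem_closure_iff.2 fun O hO hyO => ?_
      obtain ⟨t, ht⟩ := (mapClusterPt_iff_frequently.1 hy O (hO.mem_nhds hyO)).exists
      exact ⟨e t, ht, t, rfl⟩
    rcases hcl hyc with ⟨t, rfl⟩ | h
    · rw [he.isInducing.mapClusterPt_iff] at hy
      exact absurd (disjoint_nhds_atTop t) (fun h => (clusterPt_iff_not_disjoint.1 hy) h)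
    · exact h
  obtain ⟨v, hv⟩ := exists_clusterPt_of_compactSpace (map e atTop)
  refine ⟨v, hclus v hv, le_nhds_of_unique_clusterPt fun y hy => ?_⟩
  by_contra hyv
  obtain ⟨O₁, O₂, hO₁, hO₂, h1, h2, hd⟩ := normal_separation (isClosed_singleton (x := v))
    (hV.subset (sdiff_subset (t := {v}))).isClosed disjoint_sdiff_right
  have hev : ∀ᶠ t in atTop, e t ∈ O₁ ∪ O₂ := by
    by_contra hcon
    obtain ⟨a, ha, hac⟩ := (hO₁.union hO₂).isClosed_compl.isCompact.exists_mapClusterPt_of_frequently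
      (not_eventually.1 hcon)
    by_cases hav : a = v
    · exact ha (Or.inl (h1 hav))
    · exact ha (Or.inr (h2 ⟨hclus a hac, hav⟩))
  obtain ⟨T, hT⟩ := eventually_atTop.1 hev
  have hfreq : ∀ z O, MapClusterPt z atTop e → IsOpen O → z ∈ O → (e '' Ici T ∩ O).Nonempty := by
    intro z O hz hO hzO
    obtain ⟨t, ht, htT⟩ := ((mapClusterPt_iff_frequently.1 hz O (hO.mem_nhds hzO)).and_eventually
      (eventually_ge_atTop T)).exists
    exact ⟨e t, ⟨t, htT, rfl⟩, ht⟩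
  have hsub := IsPreconnected.subset_left_of_subset_union hO₁ hO₂ hd (image_subset_iff.2 hT)
    (hfreq v O₁ hv hO₁ (h1 rfl)) (isPreconnected_Ici.image e he.continuous.continuousOn)
  obtain ⟨w, hw, hw2⟩ := hfreq y O₂ hy hO₂ (h2 ⟨hclus y hy, hyv⟩)
  exact disjoint_left.1 hd (hsub hw) hw2

lemma exists_tendsto_atBot [T2Space G] [CompactSpace G] {V : Set G} (hV : V.Finite) {e : ℝ → G}
    (he : IsEmbedding e) (hcl : closure (range e) ⊆ range e ∪ V) :
    ∃ v ∈ V, Tendsto e atBot (𝓝 v) := by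
  have hr : range (fun s => e (-s)) = range e := (Equiv.neg ℝ).surjective.range_comp e
  obtain ⟨v, hv, h⟩ := exists_tendsto_atTop hV (e := fun s => e (-s))
    (he.comp (Homeomorph.neg ℝ).isEmbedding) (by rwa [hr])
  exact ⟨v, hv, by simpa [comp_def] using h.comp tendsto_neg_atBot_atTop⟩

lemma IsOpenArc.exists_isEmbedding {A : Set G} (hA : IsOpenArc A) :
    ∃ e : ℝ → G, IsEmbedding e ∧ range e = A := by
  obtain ⟨φ⟩ := hA
  let ψ : Ioo (-1 : ℝ) 1 ≃ₜ Ioo (0 : ℝ) 1 :=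
    (affineHomeomorph (1 / 2 : ℝ) (1 / 2) (by norm_num)).subtype fun x => by
      simp only [affineHomeomorph_apply, mem_Ioo]
      constructor <;> rintro ⟨h, h'⟩ <;> constructor <;> linarith
  let χ : ℝ ≃ₜ A := ((orderIsoIooNegOneOne ℝ).toHomeomorph.trans ψ).trans φ.symm
  refine ⟨fun t => χ t, IsEmbedding.subtypeVal.comp χ.isEmbedding, ?_⟩
  rw [show (fun t => (χ t : G)) = Subtype.val ∘ χ from rfl, χ.surjective.range_comp,
    Subtype.range_coe]

lemma closure_connectedComponentIn_subset (F : Set G) (x : G) :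
    closure (connectedComponentIn F x) ⊆ connectedComponentIn F x ∪ Fᶜ := by
  intro y hy
  by_cases hyF : y ∈ F
  swap
  · exact Or.inr hyF
  left
  by_cases hx : x ∈ F
  · refine (isPreconnected_connectedComponentIn.subset_closure (subset_insert y _)
      (insert_subset hy subset_closure)).subset_connectedComponentIn
      (Or.inr (mem_connectedComponentIn hx)) ?_ (mem_insert y _)
    exact insert_subset hyF (connectedComponentIn_subset F x)
  · rw [connectedComponentIn_eq_empty hx, closure_empty] at hy
    exact hy.elim

end Graph

section Edges

variable {G : Type*} [MetricSpace G] {V : Set G}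

lemma IsTopGraph.not_isCircle_of_inter_subset_pair (hG : IsTopGraph V) {C : Set G} {u v : G}
    (h : C ∩ V ⊆ {u, v}) : ¬ IsCircle C := by
  intro hC
  have h3 := hG.circle_vertices C hC
  have h2 : (C ∩ V).ncard ≤ 2 :=
    (ncard_le_ncard h (toFinite _)).trans
      ((ncard_insert_le u {v}).trans (by rw [ncard_singleton]))
  omega

/-- The edges of a graph are the components of the complement of the vertex set. -/
def edgeSets (V : Set G) : Set (Set G) := {A | IsCompOf A Vᶜ}

lemma IsTopGraph.exists_isEmbedding_edge (hG : IsTopGraph V) {A : Set G} (hA : A ∈ edgeSets V) :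
    ∃ e : ℝ → G, IsEmbedding e ∧ range e = A ∧ ∃ u ∈ V, ∃ v ∈ V, u ≠ v ∧
      Tendsto e atBot (𝓝 u) ∧ Tendsto e atTop (𝓝 v) := by
  have := hG.compact
  obtain ⟨x, hx, rfl⟩ := hA
  obtain ⟨e, he, hr⟩ := (hG.component_openArc x hx).exists_isEmbedding
  have hcl : closure (range e) ⊆ range e ∪ V := by
    simpa only [hr, compl_compl] using closure_connectedComponentIn_subset Vᶜ x
  obtain ⟨u, hu, hbot⟩ := exists_tendsto_atBot hG.finite_vertexSet he hcl
  obtain ⟨v, hv, htop⟩ := exists_tendsto_atTop hG.finite_vertexSet he hcl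
  refine ⟨e, he, hr, u, hu, v, hv, ?_, hbot, htop⟩
  rintro rfl
  have hrV : range e ⊆ Vᶜ := hr ▸ connectedComponentIn_subset Vᶜ x
  refine hG.not_isCircle_of_inter_subset_pair (u := u) (v := u) ?_
    (isCircle_insert_range he.continuous he.injective (fun h => hrV h hu) htop hbot)
  rintro y ⟨rfl | hy, hyV⟩
  · exact Or.inl rfl
  · exact absurd hyV (hrV hy)

lemma disjoint_of_mem_edgeSets {A B : Set G} (hA : A ∈ edgeSets V) (hB : B ∈ edgeSets V)
    (hAB : A ≠ B) : Disjoint A B := by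
  obtain ⟨x, -, rfl⟩ := hA
  obtain ⟨y, -, rfl⟩ := hB
  rw [disjoint_left]
  intro z hzx hzy
  exact hAB ((connectedComponentIn_eq hzx).trans (connectedComponentIn_eq hzy).symm)

lemma subset_compl_of_mem_edgeSets {A : Set G} (hA : A ∈ edgeSets V) : A ⊆ Vᶜ := by
  obtain ⟨x, -, rfl⟩ := hA
  exact connectedComponentIn_subset Vᶜ x

lemma IsTopGraph.finite_edgeSets (hG : IsTopGraph V) : (edgeSets V).Finite := by
  have : Nonempty G := hG.connected.toNonempty
  choose! e he hr u hu v hv huv hbot htop using fun A => hG.exists_isEmbedding_edge (A := A)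
  refine Set.Finite.of_finite_image (f := fun A => (u A, v A))
    ((hG.finite_vertexSet.prod hG.finite_vertexSet).subset ?_) ?_
  · rintro _ ⟨A, hA, rfl⟩
    exact ⟨hu A hA, hv A hA⟩
  · intro A hA B hB hAB
    simp only [Prod.mk.injEq] at hAB
    by_contra hne
    have hd := disjoint_of_mem_edgeSets hA hB hne
    have hAV := subset_compl_of_mem_edgeSets hA
    have hBV := subset_compl_of_mem_edgeSets hB
    rw [← hr A hA] at hAV
    rw [← hr B hB] at hBV
    refine hG.not_isCircle_of_inter_subset_pair (u := u A) (v := v A) ?_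
      (isCircle_of_two_arcs (he A hA).continuous (he B hB).continuous (he A hA).injective
        (he B hB).injective (by rwa [hr A hA, hr B hB]) (huv A hA) (fun h => hAV h (hu A hA))
        (fun h => hBV h (hu A hA)) (fun h => hAV h (hv A hA)) (fun h => hBV h (hv A hA))
        (hbot A hA) (hAB.1 ▸ hbot B hB) (htop A hA) (hAB.2 ▸ htop B hB))
    rintro y ⟨rfl | ⟨t, rfl⟩, hyV⟩
    · exact Or.inl rfl
    · unfold joinArcs at hyV ⊢
      split_ifs at hyV ⊢
      · exact Or.inr rfl
      · exact absurd hyV (hAV ⟨_, rfl⟩)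
      · exact absurd hyV (hBV ⟨_, rfl⟩)

lemma IsTopGraph.isOpen_of_mem_edgeSets (hG : IsTopGraph V) {A : Set G} (hA : A ∈ edgeSets V) :
    IsOpen A := by
  have hc : Aᶜ = V ∪ ⋃ B ∈ edgeSets V \ {A}, (B ∪ V) := by
    ext y
    simp only [mem_compl_iff, mem_union, mem_iUnion, exists_prop]
    constructor
    · intro hy
      by_cases hyV : y ∈ V
      · exact Or.inl hyV
      · exact Or.inr ⟨connectedComponentIn Vᶜ y, ⟨⟨y, hyV, rfl⟩,
          fun h => hy (h ▸ mem_connectedComponentIn hyV)⟩,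
          Or.inl (mem_connectedComponentIn hyV)⟩
    · rintro (hyV | ⟨B, ⟨hB, hBA⟩, hyB | hyV⟩) hyA
      · exact subset_compl_of_mem_edgeSets hA hyA hyV
      · exact disjoint_left.1 (disjoint_of_mem_edgeSets hA hB fun h => hBA h.symm) hyA hyB
      · exact subset_compl_of_mem_edgeSets hA hyA hyV
  rw [← isClosed_compl_iff, hc]
  refine hG.finite_vertexSet.isClosed.union
    ((hG.finite_edgeSets.subset sdiff_subset).isClosed_biUnion ?_)
  rintro B ⟨⟨x, -, rfl⟩, -⟩
  refine isClosed_of_closure_subset ?_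
  rw [closure_union, hG.finite_vertexSet.isClosed.closure_eq]
  refine union_subset ?_ subset_union_right
  simpa only [compl_compl] using closure_connectedComponentIn_subset Vᶜ x

lemma IsTopGraph.exists_isOpenEmbedding_edge (hG : IsTopGraph V) {A : Set G}
    (hA : A ∈ edgeSets V) : ∃ e : ℝ → G, IsOpenEmbedding e ∧ range e = A := by
  obtain ⟨e, he, hr, -⟩ := hG.exists_isEmbedding_edge hA
  exact ⟨e, ⟨he, hr ▸ hG.isOpen_of_mem_edgeSets hA⟩, hr⟩

lemma IsTopGraph.finite_frontier (hG : IsTopGraph V) {C : Set G} (hC : IsPreconnected C)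
    (hCc : IsClosed C) : (frontier C).Finite := by
  refine (hG.finite_vertexSet.union (hG.finite_edgeSets.biUnion
    (t := fun A => frontier C ∩ A) fun A hA => ?_)).subset ?_
  · obtain ⟨e, he, rfl⟩ := hG.exists_isOpenEmbedding_edge hA
    exact hC.finite_frontier_inter_range he hCc
  · intro y hy
    by_cases hyV : y ∈ V
    · exact Or.inl hyV
    · exact Or.inr (mem_iUnion₂.2 ⟨_, ⟨y, hyV, rfl⟩, hy, mem_connectedComponentIn hyV⟩)

end Edges

/-- if `cl(R(f)) = G` and `P(f) ≠ ∅`, then `cl(P(f)) = G`. -/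
theorem dense_periodic_of_dense_recurrent {G : Type*} [MetricSpace G] (V : Set G)
    (hG : IsTopGraph V) (f : G → G) (hf : Continuous f)
    (hR : closure (recurrentPts f) = Set.univ)
    (hP : (Function.periodicPts f).Nonempty) :
    closure (Function.periodicPts f) = Set.univ := by
  have := hG.nontrivial
  have := hG.compact
  have := hG.connected
  have hRd : Dense (recurrentPts f) := dense_iff_closure_eq.2 hR
  by_contra hcon
  have hne : (closure (periodicPts f))ᶜ.Nonempty := nonempty_compl.2 hcon
  obtain ⟨y, hyV, hy⟩ := (dense_univ.sdiff_finite hG.finite_vertexSet).exists_mem_open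
    isClosed_closure.isOpen_compl hne
  obtain ⟨e, he, hr⟩ := hG.exists_isOpenEmbedding_edge (A := connectedComponentIn Vᶜ y)
    ⟨y, hyV.2, rfl⟩
  obtain ⟨t, rfl⟩ : y ∈ range e := hr ▸ mem_connectedComponentIn hyV.2
  obtain ⟨l, r, htlr, hlr⟩ := mem_nhds_iff_exists_Ioo_subset.1
    ((isClosed_closure.isOpen_compl.preimage he.continuous).mem_nhds hy)
  have hJ : ∀ s ∈ Ioo l r, e s ∉ periodicPts f := fun s hs h => hlr hs (subset_closure h)
  obtain ⟨l', r', hl, hlr', hr', hrec⟩ := exists_Ioo_recurrent hf he hRd (htlr.1.trans htlr.2) hJ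
  have hJ' : ∀ s ∈ Ioo l' r', e s ∉ periodicPts f :=
    fun s hs => hJ s ⟨hl.trans_lt hs.1, hs.2.trans_le hr'⟩
  obtain ⟨a, b, hla, hab, hbr, hret⟩ := exists_Icc_returning he hlr' hJ' hrec
  have hK : IsCompact (e '' Icc a b) := isCompact_Icc.image he.continuous
  obtain ⟨M, hM₀, hM⟩ := exists_invariant_orbit_segment hf hK (he.isOpenMap _ isOpen_Ioo)
    (image_mono Ioo_subset_Icc_self) (by rintro _ ⟨s, hs, rfl⟩; exact hret s hs)
  set S := ⋃ i ∈ Finset.range M, f^[i] '' (e '' Icc a b) with hS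
  have hpc : ∀ i, IsClosed (f^[i] '' (e '' Icc a b)) :=
    fun i => (hK.image (hf.iterate i)).isClosed
  have hSc : IsClosed S := isClosed_biUnion_finset fun i _ => hpc i
  have hSP : ∀ x ∈ S, x ∉ periodicPts f := by
    intro x hx hxP
    obtain ⟨i, -, _, ⟨s, hs, rfl⟩, rfl⟩ := mem_iUnion₂.1 hx
    have hs' : s ∈ Ioo l' r' := ⟨hla.trans_le hs.1, hs.2.trans_lt hbr⟩
    exact hJ' s hs' (mem_periodicPts_of_recurrent (hrec s hs') hxP)
  have hSfr : (frontier S).Finite := by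
    refine ((Finset.range M).finite_toSet.biUnion (t := fun i => frontier (f^[i] '' (e '' Icc a b)))
      fun i _ => hG.finite_frontier ?_ (hpc i)).subset ?_
    · exact (isPreconnected_Icc.image e he.continuous.continuousOn).image _
        (hf.iterate i).continuousOn
    · intro x hx
      rw [hSc.frontier_eq] at hx
      obtain ⟨i, hi, hxi⟩ := mem_iUnion₂.1 hx.1
      refine mem_iUnion₂.2 ⟨i, hi, ?_⟩
      rw [(hpc i).frontier_eq]
      exact ⟨hxi, fun h => hx.2 (interior_mono
          (subset_biUnion_of_mem (u := fun i => f^[i] '' (e '' Icc a b)) hi) h)⟩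
  have hSne : S.Nonempty :=
    ⟨e a, mem_iUnion₂.2 ⟨0, Finset.mem_range.2 hM₀, e a, ⟨a, ⟨le_rfl, hab.le⟩, rfl⟩, rfl⟩⟩
  by_cases hfr : (frontier S).Nonempty
  · obtain ⟨x, hx, hxP⟩ := exists_periodicPt_of_finite hSfr hfr
      (mapsTo_frontier_of_dense_recurrent hf hRd hSc hM)
    exact hSP x (hSc.frontier_subset hx) hxP
  · have hclopen : IsClopen S :=
      isClopen_iff_frontier_eq_empty.2 (not_nonempty_iff_eq_empty.1 hfr)
    obtain ⟨p, hp⟩ := hP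
    exact hSP p (hclopen.eq_univ hSne ▸ mem_univ p) hp
end

section
/- Let f : G → G be a graph map and let W be a subset of G − cl(P(f)). If W ∩ C = ∅ for every circle C ⊆ G − cl(P(f)), then W ∩ cl(R(f)) = ∅. In particular, if W is a connected component of G − cl(P(f)) containing no circle then W ∩ cl(R(f)) = ∅, and if G − cl(P(f)) contains no circle then cl(R(f)) = cl(P(f)). -/
open Set Function Filter Topology Metric

section Circles

theorem isCircle_iff_exists_addCircle_param {G : Type*} [TopologicalSpace G] [T2Space G]
    {T : ℝ} [hT : Fact (0 < T)] {C : Set G} :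
    IsCircle C ↔ ∃ e : AddCircle T → G, Continuous e ∧ Injective e ∧ range e = C := by
  have h₁ : AddCircle T ≃ₜ Metric.sphere (0 : ℂ) 1 := AddCircle.homeomorphCircle hT.out.ne'
  constructor
  · rintro ⟨h⟩
    refine ⟨fun t ↦ (h.symm (h₁ t) : G), by fun_prop, ?_, ?_⟩
    · intro s t hst
      exact h₁.injective (h.symm.injective (Subtype.ext hst))
    · ext z
      constructor
      · rintro ⟨t, rfl⟩
        exact Subtype.coe_prop _
      · intro hz
        exact ⟨h₁.symm (h ⟨z, hz⟩), by simp⟩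
  · rintro ⟨e, hc, hi, rfl⟩
    have he : IsEmbedding e := (hc.isClosedEmbedding hi).isEmbedding
    exact ⟨he.toHomeomorph.symm.trans h₁⟩

theorem isCircle_image_Icc {G : Type*} [TopologicalSpace G] [T2Space G] {γ : ℝ → G} {p q : ℝ}
    (hpq : p < q) (hc : ContinuousOn γ (Icc p q)) (hi : InjOn γ (Ico p q)) (hend : γ p = γ q) :
    IsCircle (γ '' Icc p q) := by
  have : Fact (0 < q - p) := ⟨sub_pos.2 hpq⟩
  have hq : p + (q - p) = q := by ring
  have hval : ∀ t ∈ Ico p q, AddCircle.liftIco (q - p) p γ t = γ t := fun t ht ↦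
    AddCircle.liftIco_coe_apply (by rwa [hq])
  have hsurj : ∀ z : AddCircle (q - p), ∃ t ∈ Ico p q, (t : AddCircle (q - p)) = z := by
    intro z
    have := AddCircle.coe_image_Ico_eq (q - p) p ▸ mem_univ z
    rwa [hq] at this
  refine (isCircle_iff_exists_addCircle_param (T := q - p)).2
    ⟨AddCircle.liftIco (q - p) p γ, ?_, ?_, ?_⟩
  · exact AddCircle.liftIco_continuous (by rwa [hq]) (by rwa [hq])
  · intro y z hyz
    obtain ⟨s, hs, rfl⟩ := hsurj y
    obtain ⟨t, ht, rfl⟩ := hsurj z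
    rw [hval s hs, hval t ht] at hyz
    rw [hi hs ht hyz]
  · ext z
    constructor
    · rintro ⟨y, rfl⟩
      obtain ⟨s, hs, rfl⟩ := hsurj y
      exact ⟨s, Ico_subset_Icc_self hs, (hval s hs).symm⟩
    · rintro ⟨t, ht, rfl⟩
      rcases ht.2.lt_or_eq with h | rfl
      · exact ⟨t, hval t ⟨ht.1, h⟩⟩
      · exact ⟨(p : ℝ), by rw [hval p ⟨le_rfl, hpq⟩, hend]⟩

/-- Two arcs meeting exactly at their end points form a circle. -/
theorem isCircle_union_arcs {G : Type*} [TopologicalSpace G] [T2Space G] {γ δ : ℝ → G}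
    {p q r s : ℝ} (hpq : p < q) (hrs : r < s)
    (hγ : ContinuousOn γ (Icc p q)) (hδ : ContinuousOn δ (Icc r s))
    (hγi : InjOn γ (Icc p q)) (hδi : InjOn δ (Icc r s)) (h₁ : γ q = δ r) (h₂ : δ s = γ p)
    (hmeet : ∀ t ∈ Icc p q, ∀ u ∈ Icc r s, γ t = δ u → u = r ∨ u = s) :
    IsCircle (γ '' Icc p q ∪ δ '' Icc r s) := by
  set κ : ℝ → G := fun t ↦ if t ≤ q then γ t else δ (t - q + r) with hκ
  have hκ₁ : ∀ t ∈ Icc p q, κ t = γ t := fun t ht ↦ if_pos ht.2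
  have hκ₂ : ∀ t ∈ Icc q (q + (s - r)), κ t = δ (t - q + r) := by
    intro t ht
    rcases ht.1.eq_or_lt with rfl | h
    · simp [hκ, h₁]
    · exact if_neg (not_le.2 h)
  have hmaps : MapsTo (fun t ↦ t - q + r) (Icc q (q + (s - r))) (Icc r s) := by
    intro t ht
    constructor <;> linarith [ht.1, ht.2]
  have hIcc : Icc p q ∪ Icc q (q + (s - r)) = Icc p (q + (s - r)) :=
    Icc_union_Icc_eq_Icc hpq.le (by linarith)
  have himg : κ '' Icc p (q + (s - r)) = γ '' Icc p q ∪ δ '' Icc r s := by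
    rw [← hIcc, image_union]
    congr 1
    · exact image_congr hκ₁
    · rw [image_congr hκ₂]
      ext z
      constructor
      · rintro ⟨t, ht, rfl⟩
        exact ⟨_, hmaps ht, rfl⟩
      · rintro ⟨t, ht, rfl⟩
        exact ⟨t - r + q, ⟨by linarith [ht.1], by linarith [ht.2]⟩, by simp⟩
  rw [← himg]
  refine isCircle_image_Icc (by linarith) ?_ ?_ ?_
  · rw [← hIcc]
    refine ContinuousOn.union_of_isClosed (hγ.congr hκ₁) ?_ isClosed_Icc isClosed_Icc
    exact (hδ.comp (by fun_prop) hmaps).congr hκ₂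
  · have key : ∀ t ∈ Icc p q, ∀ u ∈ Ico p (q + (s - r)), q < u → κ t ≠ κ u := by
      intro t ht u hu hqu htu
      have hu' : u ∈ Icc q (q + (s - r)) := ⟨hqu.le, hu.2.le⟩
      rw [hκ₁ t ht, hκ₂ u hu'] at htu
      rcases hmeet t ht _ (hmaps hu') htu with h | h
      · linarith
      · linarith [hu.2]
    intro t ht u hu htu
    rcases le_or_gt t q with h | h <;> rcases le_or_gt u q with h' | h'
    · rw [hκ₁ t ⟨ht.1, h⟩, hκ₁ u ⟨hu.1, h'⟩] at htu
      exact hγi ⟨ht.1, h⟩ ⟨hu.1, h'⟩ htu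
    · exact absurd htu (key t ⟨ht.1, h⟩ u hu h')
    · exact absurd htu.symm (key u ⟨hu.1, h'⟩ t ht h)
    · have h₃ : t ∈ Icc q (q + (s - r)) := ⟨h.le, ht.2.le⟩
      have h₄ : u ∈ Icc q (q + (s - r)) := ⟨h'.le, hu.2.le⟩
      rw [hκ₂ t h₃, hκ₂ u h₄] at htu
      have := hδi (hmaps h₃) (hmaps h₄) htu
      linarith
  · rw [hκ₁ p ⟨le_rfl, hpq.le⟩, hκ₂ _ ⟨by linarith, le_rfl⟩, ← h₂]
    congr 1
    ring

theorem IsCircle.isCompact {G : Type*} [TopologicalSpace G] [T2Space G] {C : Set G}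
    (hC : IsCircle C) : IsCompact C := by
  have : Fact ((0 : ℝ) < 1) := ⟨one_pos⟩
  obtain ⟨e, hc, -, rfl⟩ := (isCircle_iff_exists_addCircle_param (T := 1)).1 hC
  exact isCompact_range hc

theorem IsCircle.isPreconnected {G : Type*} [TopologicalSpace G] [T2Space G] {C : Set G}
    (hC : IsCircle C) : IsPreconnected C := by
  have : Fact ((0 : ℝ) < 1) := ⟨one_pos⟩
  obtain ⟨e, hc, -, rfl⟩ := (isCircle_iff_exists_addCircle_param (T := 1)).1 hC
  exact isPreconnected_range hc

theorem IsCircle.isPreconnected_diff_singleton {G : Type*} [TopologicalSpace G] [T2Space G]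
    {C : Set G} (hC : IsCircle C) {c : G} (hc : c ∈ C) : IsPreconnected (C \ {c}) := by
  have : Fact ((0 : ℝ) < 1) := ⟨one_pos⟩
  obtain ⟨e, hec, hei, rfl⟩ := (isCircle_iff_exists_addCircle_param (T := 1)).1 hC
  obtain ⟨z, rfl⟩ := hc
  obtain ⟨a, rfl⟩ := QuotientAddGroup.mk_surjective z
  have h := (AddCircle.openPartialHomeomorphCoe (1 : ℝ) a).image_source_eq_target
  have h' : range e \ {e (a : AddCircle (1 : ℝ))} =
      (fun t : ℝ ↦ e (t : AddCircle (1 : ℝ))) '' Ioo a (a + 1) := by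
    have : e '' ((fun t : ℝ ↦ (t : AddCircle (1 : ℝ))) '' Ioo a (a + 1)) =
        e '' {(a : AddCircle (1 : ℝ))}ᶜ := congrArg (e '' ·) h
    rw [← image_comp] at this
    exact (this.trans (by rw [image_compl_eq_range_sdiff_image hei, image_singleton])).symm
  change IsPreconnected (range e \ {e (a : AddCircle (1 : ℝ))})
  rw [h']
  exact isPreconnected_Ioo.image _ (hec.comp (AddCircle.continuous_mk' 1)).continuousOn

end Circles

section Arcs

variable {G : Type*} [TopologicalSpace G] {O : Set G} {x y z : G}

/-- `x` and `y` are the end points of a (possibly degenerate) arc contained in `O`. -/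
def ArcJoinedIn (O : Set G) (x y : G) : Prop :=
  ∃ (γ : ℝ → G) (p q : ℝ), p ≤ q ∧ ContinuousOn γ (Icc p q) ∧ InjOn γ (Icc p q) ∧
    MapsTo γ (Icc p q) O ∧ γ p = x ∧ γ q = y

theorem ArcJoinedIn.right_mem (h : ArcJoinedIn O x y) : y ∈ O := by
  obtain ⟨γ, p, q, hpq, -, -, hm, -, rfl⟩ := h
  exact hm ⟨hpq, le_rfl⟩

theorem ArcJoinedIn.symm (h : ArcJoinedIn O x y) : ArcJoinedIn O y x := by
  obtain ⟨γ, p, q, hpq, hc, hi, hm, rfl, rfl⟩ := h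
  have hmaps : MapsTo (fun t : ℝ ↦ -t) (Icc (-q) (-p)) (Icc p q) := by
    intro t ht
    constructor <;> linarith [ht.1, ht.2]
  exact ⟨fun t ↦ γ (-t), -q, -p, neg_le_neg hpq, hc.comp (by fun_prop) hmaps,
    hi.comp neg_injective.injOn hmaps, hm.comp hmaps, by simp, by simp⟩

theorem arcJoinedIn_of_uIcc {ψ : ℝ → G} {s t : ℝ} (hc : ContinuousOn ψ (uIcc s t))
    (hi : InjOn ψ (uIcc s t)) (hm : MapsTo ψ (uIcc s t) O) : ArcJoinedIn O (ψ s) (ψ t) := by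
  rcases le_total s t with h | h
  · rw [uIcc_of_le h] at hc hi hm
    exact ⟨ψ, s, t, h, hc, hi, hm, rfl, rfl⟩
  · rw [uIcc_of_ge h] at hc hi hm
    exact ArcJoinedIn.symm ⟨ψ, t, s, h, hc, hi, hm, rfl, rfl⟩

theorem ArcJoinedIn.trans [T2Space G] (h₁ : ArcJoinedIn O x y) (h₂ : ArcJoinedIn O y z) :
    ArcJoinedIn O x z := by
  obtain ⟨γ, p, q, hpq, hc, hi, hm, rfl, hy⟩ := h₁
  obtain ⟨δ, r, s, hrs, hc', hi', hm', rfl, rfl⟩ := h₂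
  have hcl : IsCompact (Icc p q ∩ γ ⁻¹' (δ '' Icc r s)) :=
    isCompact_Icc.of_isClosed_subset
      (hc.preimage_isClosed_of_isClosed isClosed_Icc
        (isCompact_Icc.image_of_continuousOn hc').isClosed) inter_subset_left
  obtain ⟨t₀, ⟨ht₀, s₀, hs₀, heq⟩, hmin⟩ :=
    hcl.exists_isLeast ⟨q, ⟨hpq, le_rfl⟩, r, ⟨le_rfl, hrs⟩, hy.symm⟩
  set κ : ℝ → G := fun t ↦ if t ≤ t₀ then γ t else δ (t - t₀ + s₀) with hκ
  have hκ₁ : ∀ t ∈ Icc p t₀, κ t = γ t := fun t ht ↦ if_pos ht.2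
  have hκ₂ : ∀ t ∈ Icc t₀ (t₀ + (s - s₀)), κ t = δ (t - t₀ + s₀) := by
    intro t ht
    rcases ht.1.eq_or_lt with rfl | h
    · simp [hκ, heq]
    · exact if_neg (not_le.2 h)
  have hsub : Icc p t₀ ⊆ Icc p q := Icc_subset_Icc_right ht₀.2
  have hmaps : MapsTo (fun t ↦ t - t₀ + s₀) (Icc t₀ (t₀ + (s - s₀))) (Icc r s) := by
    intro t ht
    constructor <;> linarith [ht.1, ht.2, hs₀.1, hs₀.2]
  have hIcc : Icc p t₀ ∪ Icc t₀ (t₀ + (s - s₀)) = Icc p (t₀ + (s - s₀)) :=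
    Icc_union_Icc_eq_Icc ht₀.1 (by linarith [hs₀.2])
  refine ⟨κ, p, t₀ + (s - s₀), by linarith [ht₀.1, hs₀.2], ?_, ?_, ?_, ?_, ?_⟩
  · rw [← hIcc]
    refine ContinuousOn.union_of_isClosed ((hc.mono hsub).congr hκ₁) ?_ isClosed_Icc isClosed_Icc
    exact (hc'.comp (by fun_prop) hmaps).congr hκ₂
  · have key : ∀ t ∈ Icc p t₀, ∀ u ∈ Icc t₀ (t₀ + (s - s₀)), t₀ < u → κ t ≠ κ u := by
      intro t ht u hu hu₀ htu
      rw [hκ₁ t ht, hκ₂ u hu] at htu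
      have hle : t₀ ≤ t := hmin ⟨hsub ht, _, hmaps hu, htu.symm⟩
      obtain rfl : t = t₀ := le_antisymm ht.2 hle
      have := hi' hs₀ (hmaps hu) (heq.trans htu)
      linarith
    intro t ht u hu htu
    rcases le_or_gt t t₀ with h | h <;> rcases le_or_gt u t₀ with h' | h'
    · rw [hκ₁ t ⟨ht.1, h⟩, hκ₁ u ⟨hu.1, h'⟩] at htu
      exact hi (hsub ⟨ht.1, h⟩) (hsub ⟨hu.1, h'⟩) htu
    · exact absurd htu (key t ⟨ht.1, h⟩ u ⟨h'.le, hu.2⟩ h')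
    · exact absurd htu.symm (key u ⟨hu.1, h'⟩ t ⟨h.le, ht.2⟩ h)
    · have h₃ : t ∈ Icc t₀ (t₀ + (s - s₀)) := ⟨h.le, ht.2⟩
      have h₄ : u ∈ Icc t₀ (t₀ + (s - s₀)) := ⟨h'.le, hu.2⟩
      rw [hκ₂ t h₃, hκ₂ u h₄] at htu
      have := hi' (hmaps h₃) (hmaps h₄) htu
      linarith
  · rw [← hIcc]
    rintro t (ht | ht)
    · rw [hκ₁ t ht]
      exact hm (hsub ht)
    · rw [hκ₂ t ht]
      exact hm' (hmaps ht)
  · exact hκ₁ p ⟨le_rfl, ht₀.1⟩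
  · rw [hκ₂ _ ⟨by linarith [hs₀.2], le_rfl⟩]
    congr 1
    ring

end Arcs

section EdgeCharts

/-- `ψ` parametrizes on `[0,1]` a closed edge of a graph with vertex set `V`. -/
structure IsEdgeChart {G : Type*} [TopologicalSpace G] (V : Set G) (ψ : ℝ → G) : Prop where
  continuousOn : ContinuousOn ψ (Icc 0 1)
  injOn : InjOn ψ (Icc 0 1)
  isOpen_image : IsOpen (ψ '' Ioo 0 1)
  notMem : ∀ t ∈ Ioo (0 : ℝ) 1, ψ t ∉ V

variable {G : Type*} [TopologicalSpace G] {V : Set G} {ψ : ℝ → G}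

theorem IsEdgeChart.reverse (h : IsEdgeChart V ψ) : IsEdgeChart V fun t ↦ ψ (1 - t) := by
  have hmaps : MapsTo (fun t : ℝ ↦ 1 - t) (Icc 0 1) (Icc 0 1) := by
    intro t ht
    constructor <;> linarith [ht.1, ht.2]
  refine ⟨h.continuousOn.comp (by fun_prop) hmaps,
    h.injOn.comp (sub_right_injective.injOn) hmaps, ?_, ?_⟩
  · have : (fun t ↦ ψ (1 - t)) '' Ioo (0 : ℝ) 1 = ψ '' Ioo 0 1 := by
      rw [← image_image ψ (fun t ↦ 1 - t), image_const_sub_Ioo]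
      norm_num
    rw [this]
    exact h.isOpen_image
  · exact fun t ht ↦ h.notMem _ ⟨by linarith [ht.2], by linarith [ht.1]⟩

variable [T2Space G]

theorem IsEdgeChart.isOpen_image_Ioo (h : IsEdgeChart V ψ) {a b : ℝ} (ha : 0 ≤ a) (hb : b ≤ 1) :
    IsOpen (ψ '' Ioo a b) := by
  have hK : IsClosed (ψ '' ((Icc 0 a ∪ Icc b 1) ∩ Icc 0 1)) :=
    (((isCompact_Icc.union isCompact_Icc).inter isCompact_Icc).image_of_continuousOn
      (h.continuousOn.mono inter_subset_right)).isClosed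
  have : ψ '' Ioo a b = ψ '' Ioo 0 1 \ ψ '' ((Icc 0 a ∪ Icc b 1) ∩ Icc 0 1) := by
    ext z
    constructor
    · rintro ⟨t, ht, rfl⟩
      refine ⟨⟨t, ⟨ha.trans_lt ht.1, ht.2.trans_le hb⟩, rfl⟩, ?_⟩
      rintro ⟨u, ⟨hu, hu'⟩, hut⟩
      obtain rfl := h.injOn hu' ⟨(ha.trans_lt ht.1).le, (ht.2.trans_le hb).le⟩ hut
      rcases hu with hu | hu
      · exact absurd hu.2 (not_le.2 ht.1)
      · exact absurd hu.1 (not_le.2 ht.2)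
    · rintro ⟨⟨t, ht, rfl⟩, hn⟩
      refine ⟨t, ⟨?_, ?_⟩, rfl⟩
      · by_contra! hle
        exact hn ⟨t, ⟨Or.inl ⟨ht.1.le, hle⟩, Ioo_subset_Icc_self ht⟩, rfl⟩
      · by_contra! hle
        exact hn ⟨t, ⟨Or.inr ⟨hle, ht.2.le⟩, Ioo_subset_Icc_self ht⟩, rfl⟩
  rw [this]
  exact h.isOpen_image.sdiff hK

/-- A circle that leaves an edge through the end points of a subarc, of which it contains at most
one, misses the interior of the subarc. -/
theorem IsEdgeChart.notMem_circle_of_mem_Ioo (h : IsEdgeChart V ψ) {C : Set G}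
    (hC : IsCircle C) (hCV : (C ∩ V).Nonempty) {a b : ℝ} (ha : 0 < a) (hb : b < 1)
    {c : G} (hc : c ∈ C) (hca : c = ψ a ∨ c = ψ b) (haC : ψ a ∈ C → ψ a = c)
    (hbC : ψ b ∈ C → ψ b = c) : ∀ t ∈ Ioo a b, ψ t ∉ C := by
  intro t ht htC
  obtain ⟨v, hvC, hvV⟩ := hCV
  have hsub : Icc a b ⊆ Icc 0 1 := Icc_subset_Icc ha.le hb.le
  have hv : v ∉ ψ '' Icc a b := by
    rintro ⟨u, hu, rfl⟩
    exact h.notMem u ⟨ha.trans_le hu.1, hu.2.trans_lt hb⟩ hvV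
  have hab : a < b := ht.1.trans ht.2
  have hcm : c ∈ ψ '' Icc a b := by
    rcases hca with rfl | rfl
    · exact ⟨a, ⟨le_rfl, hab.le⟩, rfl⟩
    · exact ⟨b, ⟨hab.le, le_rfl⟩, rfl⟩
  have hcn : c ∉ ψ '' Ioo a b := by
    rintro ⟨u, hu, rfl⟩
    rcases hca with hca | hca
    · exact hu.1.ne' (h.injOn (hsub (Ioo_subset_Icc_self hu)) (hsub ⟨le_rfl, hab.le⟩) hca)
    · exact hu.2.ne (h.injOn (hsub (Ioo_subset_Icc_self hu)) (hsub ⟨hab.le, le_rfl⟩) hca)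
  have hK : IsClosed (ψ '' Icc a b) :=
    (isCompact_Icc.image_of_continuousOn (h.continuousOn.mono hsub)).isClosed
  obtain ⟨w, -, hw₁, hw₂⟩ := hC.isPreconnected_diff_singleton hc (ψ '' Ioo a b) (ψ '' Icc a b)ᶜ
    (h.isOpen_image_Ioo ha.le hb.le) hK.isOpen_compl
    (by
      rintro w ⟨hwC, hwc⟩
      by_cases hw : w ∈ ψ '' Icc a b
      · left
        obtain ⟨u, hu, rfl⟩ := hw
        refine ⟨u, ⟨hu.1.lt_of_ne ?_, hu.2.lt_of_ne ?_⟩, rfl⟩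
        · rintro rfl
          exact hwc (haC hwC)
        · rintro rfl
          exact hwc (hbC hwC)
      · exact Or.inr hw)
    ⟨ψ t, ⟨htC, fun e ↦ hcn (e ▸ ⟨t, ht, rfl⟩)⟩, t, ht, rfl⟩
    ⟨v, ⟨hvC, fun e ↦ hv (by rw [mem_singleton_iff] at e; rwa [e])⟩, hv⟩
  exact hw₂ (image_mono Ioo_subset_Icc_self hw₁)

theorem IsEdgeChart.mem_circle_of_lt (h : IsEdgeChart V ψ) {C : Set G}
    (hC : IsCircle C) (hCV : (C ∩ V).Nonempty) {t r : ℝ} (ht : t ∈ Ioo (0 : ℝ) 1) (htr : t < r)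
    (hr : r < 1) (htC : ψ t ∈ C) : ψ r ∈ C := by
  by_contra hrC
  have hfree : ∀ u ∈ Ioo (0 : ℝ) r, ψ u ∈ C → u = t := by
    intro u hu huC
    rcases lt_trichotomy u t with hut | hut | hut
    · exact absurd htC (h.notMem_circle_of_mem_Ioo hC hCV hu.1 hr huC (Or.inl rfl)
        (fun _ ↦ rfl) (fun h' ↦ absurd h' hrC) t ⟨hut, htr⟩)
    · exact hut
    · exact absurd huC (h.notMem_circle_of_mem_Ioo hC hCV ht.1 hr htC (Or.inl rfl)
        (fun _ ↦ rfl) (fun h' ↦ absurd h' hrC) u ⟨hut, hu.2⟩)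
  obtain ⟨v, hvC, hvV⟩ := hCV
  obtain ⟨w, hwC, ⟨u, hu, rfl⟩, hw⟩ := hC.isPreconnected (ψ '' Ioo 0 r) {ψ t}ᶜ
    (h.isOpen_image_Ioo le_rfl hr.le) isClosed_singleton.isOpen_compl
    (by
      intro w _
      by_cases hw : w = ψ t
      · exact Or.inl (hw ▸ ⟨t, ⟨ht.1, htr⟩, rfl⟩)
      · exact Or.inr hw)
    ⟨ψ t, htC, t, ⟨ht.1, htr⟩, rfl⟩
    ⟨v, hvC, fun e ↦ h.notMem t ht (by rw [mem_singleton_iff] at e; rwa [← e])⟩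
  exact hw (by rw [hfree u hu hwC]; rfl)

/-- A circle that meets an open edge contains the closed edge. -/
theorem IsEdgeChart.image_subset_circle (h : IsEdgeChart V ψ) {C : Set G}
    (hC : IsCircle C) (hCV : (C ∩ V).Nonempty) {t : ℝ} (ht : t ∈ Ioo (0 : ℝ) 1)
    (htC : ψ t ∈ C) : ψ '' Icc 0 1 ⊆ C := by
  have hIoo : ψ '' Ioo 0 1 ⊆ C := by
    rintro _ ⟨r, hr, rfl⟩
    rcases lt_trichotomy t r with hlt | rfl | hlt
    · exact h.mem_circle_of_lt hC hCV ht hlt hr.2 htC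
    · exact htC
    · have := h.reverse.mem_circle_of_lt hC hCV (t := 1 - t) (r := 1 - r)
        ⟨by linarith [ht.2], by linarith [ht.1]⟩ (by linarith) (by linarith [hr.1])
        (by simpa using htC)
      simpa using this
  have hcl : closure (Ioo (0 : ℝ) 1) = Icc 0 1 := closure_Ioo zero_ne_one
  rw [← hcl]
  have := ContinuousOn.image_closure (f := ψ) (s := Ioo (0 : ℝ) 1)
    (by rw [hcl]; exact h.continuousOn)
  exact this.trans (hC.isCompact.isClosed.closure_subset_iff.2 hIoo)

end EdgeCharts

section LocalArcs

variable {G : Type*} [MetricSpace G] {V : Set G} {Ψ : Set (ℝ → G)}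

theorem eventually_arcJoinedIn (hV : V.Finite) (hΨ : Ψ.Finite)
    (hchart : ∀ ψ ∈ Ψ, IsEdgeChart V ψ) (hcover : ∀ x ∉ V, ∃ ψ ∈ Ψ, x ∈ ψ '' Ioo 0 1)
    {O : Set G} (hO : IsOpen O) {z : G} (hz : z ∈ O) : ∀ᶠ y in 𝓝 z, ArcJoinedIn O z y := by
  have hzz : ArcJoinedIn O z z :=
    arcJoinedIn_of_uIcc (ψ := fun _ ↦ z) (s := 0) (t := 0) continuousOn_const (by simp)
      (fun _ _ ↦ hz)
  have h₁ : ∀ᶠ y in 𝓝 z, y ∉ V \ {z} :=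
    (hV.subset sdiff_subset).isClosed.isOpen_compl.mem_nhds (by simp)
  have h₂ : ∀ᶠ y in 𝓝 z, ∀ ψ ∈ Ψ, y ∈ ψ '' Icc (0 : ℝ) 1 → ArcJoinedIn O z y := by
    refine (eventually_all_finite hΨ).2 fun ψ hψ ↦ ?_
    have hc := (hchart ψ hψ).continuousOn
    by_cases hzψ : z ∈ ψ '' Icc (0 : ℝ) 1
    · obtain ⟨s, hs, rfl⟩ := hzψ
      obtain ⟨δ, hδ, hball⟩ := Metric.mem_nhdsWithin_iff.1 (hc s hs (hO.mem_nhds hz))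
      have hK : IsClosed (ψ '' (Icc (0 : ℝ) 1 \ Metric.ball s δ)) :=
        ((isCompact_Icc.diff Metric.isOpen_ball).image_of_continuousOn
          (hc.mono sdiff_subset)).isClosed
      have hsK : ψ s ∉ ψ '' (Icc (0 : ℝ) 1 \ Metric.ball s δ) := by
        rintro ⟨u, hu, hus⟩
        rw [(hchart ψ hψ).injOn hu.1 hs hus] at hu
        exact hu.2 (Metric.mem_ball_self hδ)
      filter_upwards [hK.isOpen_compl.mem_nhds hsK] with y hy hyψ
      obtain ⟨t, ht, rfl⟩ := hyψ
      have hts : t ∈ Metric.ball s δ := by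
        by_contra hn
        exact hy ⟨t, ⟨ht, hn⟩, rfl⟩
      have hsub : uIcc s t ⊆ Icc (0 : ℝ) 1 := ordConnected_Icc.uIcc_subset hs ht
      have hsub' : uIcc s t ⊆ Metric.ball s δ := by
        rw [Real.ball_eq_Ioo] at hts ⊢
        exact ordConnected_Ioo.uIcc_subset (by constructor <;> linarith) hts
      exact arcJoinedIn_of_uIcc (hc.mono hsub) ((hchart ψ hψ).injOn.mono hsub)
        fun u hu ↦ hball ⟨hsub' hu, hsub hu⟩
    · filter_upwards [(isCompact_Icc.image_of_continuousOn hc).isClosed.isOpen_compl.mem_nhds hzψ]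
        with y hy hy'
      exact absurd hy' hy
  filter_upwards [h₁, h₂] with y hy₁ hy₂
  by_cases hyV : y ∈ V
  · have : y = z := by
      by_contra hne
      exact hy₁ ⟨hyV, hne⟩
    rwa [this]
  · obtain ⟨ψ, hψ, hyψ⟩ := hcover y hyV
    exact hy₂ ψ hψ (image_mono Ioo_subset_Icc_self hyψ)

end LocalArcs

section Separation

theorem exists_continuousOn_leftInvOn {G : Type*} [TopologicalSpace G] [T2Space G] {ψ : ℝ → G}
    {K : Set ℝ} (hK : IsCompact K) (hc : ContinuousOn ψ K) (hi : InjOn ψ K) :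
    ∃ ρ : G → ℝ, ContinuousOn ρ (ψ '' K) ∧ ∀ t ∈ K, ρ (ψ t) = t := by
  have hρ : ∀ t ∈ K, invFunOn ψ K (ψ t) = t := fun t ht ↦ hi.leftInvOn_invFunOn ht
  refine ⟨invFunOn ψ K, ?_, hρ⟩
  rw [continuousOn_iff_isClosed]
  intro F hF
  refine ⟨ψ '' (K ∩ F), ?_, ?_⟩
  · exact ((hK.inter_right hF).image_of_continuousOn (hc.mono inter_subset_left)).isClosed
  · ext z
    constructor
    · rintro ⟨hz, t, ht, rfl⟩
      rw [mem_preimage, hρ t ht] at hz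
      exact ⟨⟨t, ⟨ht, hz⟩, rfl⟩, t, ht, rfl⟩
    · rintro ⟨⟨t, ht, rfl⟩, -⟩
      exact ⟨by rw [mem_preimage, hρ t ht.1]; exact ht.2, t, ht.1, rfl⟩

theorem exists_isCircle_of_arcJoinedIn {G : Type*} [TopologicalSpace G] [T2Space G] {ψ : ℝ → G}
    {α τ β : ℝ} (hc : ContinuousOn ψ (Icc α β)) (hi : InjOn ψ (Icc α β)) (hτ : τ ∈ Ioo α β)
    {O : Set G} (hτO : ψ τ ∉ O) (hO : ArcJoinedIn O (ψ β) (ψ α)) :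
    ∃ C : Set G, IsCircle C ∧ ψ τ ∈ C ∧ C ⊆ O ∪ ψ '' Icc α β := by
  obtain ⟨γ, p, q, hpq, hγ, hγi, hm, hp, hq⟩ := hO
  have hl : Icc α τ ⊆ Icc α β := Icc_subset_Icc_right hτ.2.le
  have hr : Icc τ β ⊆ Icc α β := Icc_subset_Icc_left hτ.1.le
  have hK₁ : IsCompact (Icc p q ∩ γ ⁻¹' (ψ '' Icc τ β)) :=
    isCompact_Icc.of_isClosed_subset
      (hγ.preimage_isClosed_of_isClosed isClosed_Icc
        (isCompact_Icc.image_of_continuousOn (hc.mono hr)).isClosed) inter_subset_left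
  obtain ⟨t₁, ⟨ht₁, b, hb, hbt⟩, hmax⟩ :=
    hK₁.exists_isGreatest ⟨p, ⟨le_rfl, hpq⟩, β, ⟨hτ.2.le, le_rfl⟩, hp.symm⟩
  have hsub : Icc t₁ q ⊆ Icc p q := Icc_subset_Icc_left ht₁.1
  have hK₂ : IsCompact (Icc t₁ q ∩ γ ⁻¹' (ψ '' Icc α τ)) :=
    isCompact_Icc.of_isClosed_subset
      ((hγ.mono hsub).preimage_isClosed_of_isClosed isClosed_Icc
        (isCompact_Icc.image_of_continuousOn (hc.mono hl)).isClosed) inter_subset_left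
  obtain ⟨t₂, ⟨ht₂, a, ha, hat⟩, hmin⟩ :=
    hK₂.exists_isLeast ⟨q, ⟨ht₁.2, le_rfl⟩, α, ⟨le_rfl, hτ.1.le⟩, hq.symm⟩
  have hbτ : τ < b := by
    refine hb.1.lt_of_ne ?_
    rintro rfl
    exact hτO (hbt ▸ hm ht₁)
  have haτ : a < τ := by
    refine ha.2.lt_of_ne ?_
    rintro rfl
    exact hτO (hat ▸ hm (hsub ht₂))
  have ht : t₁ < t₂ := by
    refine ht₂.1.lt_of_ne ?_
    rintro rfl
    have := hi (hr hb) (hl ha) (hbt.trans hat.symm)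
    linarith
  have hsubγ : Icc t₁ t₂ ⊆ Icc p q := Icc_subset_Icc ht₁.1 (ht₂.2)
  have hsubψ : Icc a b ⊆ Icc α β := Icc_subset_Icc ha.1 hb.2
  refine ⟨γ '' Icc t₁ t₂ ∪ ψ '' Icc a b, ?_, ?_, ?_⟩
  · refine isCircle_union_arcs ht (haτ.trans hbτ) (hγ.mono hsubγ) (hc.mono hsubψ)
      (hγi.mono hsubγ) (hi.mono hsubψ) hat.symm hbt ?_
    intro t ht' u hu htu
    rcases le_total u τ with h | h
    · left
      have : t₂ ≤ t := hmin ⟨⟨ht'.1, (hsubγ ht').2⟩, u, ⟨ha.1.trans hu.1, h⟩, htu.symm⟩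
      obtain rfl : t = t₂ := le_antisymm ht'.2 this
      exact hi (hsubψ hu) (hl ha) (htu.symm.trans hat.symm)
    · right
      have : t ≤ t₁ := hmax ⟨hsubγ ht', u, ⟨h, hu.2.trans hb.2⟩, htu.symm⟩
      obtain rfl : t = t₁ := le_antisymm this ht'.1
      exact hi (hsubψ hu) (hr hb) (htu.symm.trans hbt.symm)
  · exact Or.inr ⟨τ, ⟨haτ.le, hbτ.le⟩, rfl⟩
  · refine union_subset_union ?_ (image_mono hsubψ)
    rintro _ ⟨t, ht', rfl⟩
    exact hm (hsubγ ht')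

/-- Either a point of an edge lies on a circle avoiding the closed set `D`, or a subarc around it
separates `Dᶜ`, so that the coordinate of the subarc extends to a continuous function on `Dᶜ`. -/
theorem exists_isCircle_or_coordinate {G : Type*} [MetricSpace G] {V : Set G} {Ψ : Set (ℝ → G)}
    (hV : V.Finite) (hΨ : Ψ.Finite) (hchart : ∀ ψ ∈ Ψ, IsEdgeChart V ψ)
    (hcover : ∀ x ∉ V, ∃ ψ ∈ Ψ, x ∈ ψ '' Ioo 0 1) {ψ : ℝ → G} (hψ : IsEdgeChart V ψ)
    {D : Set G} (hD : IsClosed D) {α τ β : ℝ} (hα : 0 ≤ α) (hβ : β ≤ 1) (hτ : τ ∈ Ioo α β)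
    (hJ : ψ '' Icc α β ⊆ Dᶜ) :
    (∃ C : Set G, IsCircle C ∧ ψ τ ∈ C ∧ C ⊆ Dᶜ) ∨
    ∃ h : G → ℝ, ContinuousOn h Dᶜ ∧ (∀ t ∈ Icc α β, h (ψ t) = t) ∧
      (∀ z, h z ∈ Icc α β) ∧ ∀ z, h z ∈ Ioo α β → ψ (h z) = z := by
  have hαβ : α < β := hτ.1.trans hτ.2
  have hsub : Icc α β ⊆ Icc 0 1 := Icc_subset_Icc hα hβ
  have hc : ContinuousOn ψ (Icc α β) := hψ.continuousOn.mono hsub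
  have hi : InjOn ψ (Icc α β) := hψ.injOn.mono hsub
  set O : Set G := Dᶜ \ {ψ τ} with hOdef
  have hO : IsOpen O := hD.isOpen_compl.sdiff isClosed_singleton
  have hτO : ψ τ ∉ O := fun h ↦ h.2 rfl
  by_cases hjoin : ArcJoinedIn O (ψ β) (ψ α)
  · obtain ⟨C, hC, hτC, hCO⟩ := exists_isCircle_of_arcJoinedIn hc hi hτ hτO hjoin
    exact Or.inl ⟨C, hC, hτC, hCO.trans (union_subset sdiff_subset hJ)⟩
  right
  have harc : ∀ s ∈ Icc α β, ∀ t ∈ Icc α β, τ ∉ uIcc s t → ArcJoinedIn O (ψ s) (ψ t) := by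
    intro s hs t ht hn
    have hst : uIcc s t ⊆ Icc α β := ordConnected_Icc.uIcc_subset hs ht
    refine arcJoinedIn_of_uIcc (hc.mono hst) (hi.mono hst) fun u hu ↦ ⟨hJ ⟨u, hst hu, rfl⟩, ?_⟩
    intro e
    rw [hi (hst hu) ⟨hτ.1.le, hτ.2.le⟩ e] at hu
    exact hn hu
  set A : Set G := {z | ArcJoinedIn O (ψ α) z} with hA
  have hAO : A ⊆ O := fun z hz ↦ hz.right_mem
  have hAopen : IsOpen A := by
    rw [isOpen_iff_mem_nhds]
    intro z hz
    filter_upwards [eventually_arcJoinedIn hV hΨ hchart hcover hO (hAO hz)] with y hy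
    exact ArcJoinedIn.trans hz hy
  have hBopen : IsOpen (O \ A) := by
    rw [isOpen_iff_mem_nhds]
    intro z hz
    filter_upwards [eventually_arcJoinedIn hV hΨ hchart hcover hO hz.1] with y hy
    exact ⟨hy.right_mem, fun hyA ↦ hz.2 (ArcJoinedIn.trans hyA hy.symm)⟩
  have hαA : ψ α ∈ A := harc α ⟨le_rfl, hαβ.le⟩ α ⟨le_rfl, hαβ.le⟩ (by
    rw [uIcc_self, mem_singleton_iff]; exact hτ.1.ne')
  have hβA : ψ β ∉ A := fun h ↦ hjoin (ArcJoinedIn.symm h)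
  obtain ⟨ρ, hρc, hρ⟩ := exists_continuousOn_leftInvOn isCompact_Icc hc hi
  classical
  set h : G → ℝ := fun z ↦ if z ∈ ψ '' Icc α β then ρ z else if z ∈ A then α else β with hh
  have hJval : ∀ t ∈ Icc α β, h (ψ t) = t := fun t ht ↦
    (if_pos ⟨t, ht, rfl⟩).trans (hρ t ht)
  have hIooOpen : IsOpen (ψ '' Ioo α β) := hψ.isOpen_image_Ioo hα hβ
  have hτmem : ψ τ ∈ ψ '' Ioo α β := ⟨τ, hτ, rfl⟩
  have hJclosed : IsClosed (ψ '' Icc α β) := (isCompact_Icc.image_of_continuousOn hc).isClosed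
  have hend : ∀ t ∈ Icc α β, ψ t ∉ ψ '' Ioo α β → t = α ∨ t = β := by
    intro t ht hn
    by_contra! hne
    exact hn ⟨t, ⟨ht.1.lt_of_ne' hne.1, ht.2.lt_of_ne hne.2⟩, rfl⟩
  have hval₁ : ∀ z ∉ ψ '' Ioo α β, z ∈ A → h z = α := by
    intro z hz hzA
    by_cases hzJ : z ∈ ψ '' Icc α β
    · obtain ⟨t, ht, rfl⟩ := hzJ
      rcases hend t ht hz with rfl | rfl
      · exact hJval _ ht
      · exact absurd hzA hβA
    · exact (if_neg hzJ).trans (if_pos hzA)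
  have hval₂ : ∀ z ∉ ψ '' Ioo α β, z ∉ A → h z = β := by
    intro z hz hzA
    by_cases hzJ : z ∈ ψ '' Icc α β
    · obtain ⟨t, ht, rfl⟩ := hzJ
      rcases hend t ht hz with rfl | rfl
      · exact absurd hαA hzA
      · exact hJval _ ht
    · exact (if_neg hzJ).trans (if_neg hzA)
  refine ⟨h, ?_, hJval, ?_, ?_⟩
  · have hcl₁ : IsClosed ((O \ A) ∪ ψ '' Ioo α β)ᶜ := (hBopen.union hIooOpen).isClosed_compl
    have hcl₂ : IsClosed (A ∪ ψ '' Ioo α β)ᶜ := (hAopen.union hIooOpen).isClosed_compl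
    have glue : ∀ {F S : Set G}, IsClosed F → ContinuousOn h (F ∩ S) →
        ∀ z ∈ S, ContinuousWithinAt h (F ∩ S) z := by
      intro F S hF hFS z hz
      by_cases hzF : z ∈ F
      · exact hFS z ⟨hzF, hz⟩
      · exact continuousWithinAt_of_notMem_closure fun hcl ↦
          hzF (hF.closure_subset_iff.2 inter_subset_left hcl)
    intro z hz
    have hunion : Dᶜ ⊆ (ψ '' Icc α β ∩ Dᶜ ∪ ((O \ A) ∪ ψ '' Ioo α β)ᶜ ∩ Dᶜ) ∪
        (A ∪ ψ '' Ioo α β)ᶜ ∩ Dᶜ := by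
      intro w hw
      by_cases hwI : w ∈ ψ '' Ioo α β
      · exact Or.inl (Or.inl ⟨image_mono Ioo_subset_Icc_self hwI, hw⟩)
      · by_cases hwA : w ∈ A
        · exact Or.inl (Or.inr ⟨fun h' ↦ h'.elim (fun h'' ↦ h''.2 hwA) hwI, hw⟩)
        · exact Or.inr ⟨fun h' ↦ h'.elim hwA hwI, hw⟩
    refine ContinuousWithinAt.mono (((glue hJclosed ?_ z hz).union (glue hcl₁ ?_ z hz)).union
      (glue hcl₂ ?_ z hz)) hunion
    · exact (hρc.mono inter_subset_left).congr fun w hw ↦ if_pos hw.1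
    · refine (continuousOn_const (c := α)).congr fun w hw ↦ ?_
      have hwI : w ∉ ψ '' Ioo α β := fun h' ↦ hw.1 (Or.inr h')
      refine hval₁ w hwI ?_
      by_contra hwA
      exact hw.1 (Or.inl ⟨⟨hw.2, fun e ↦ hwI (by rw [mem_singleton_iff] at e; rwa [e])⟩, hwA⟩)
    · exact (continuousOn_const (c := β)).congr fun w hw ↦
        hval₂ w (fun h' ↦ hw.1 (Or.inr h')) fun h' ↦ hw.1 (Or.inl h')
  · intro z
    by_cases hz : z ∈ ψ '' Ioo α β
    · obtain ⟨t, ht, rfl⟩ := hz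
      rw [hJval t (Ioo_subset_Icc_self ht)]
      exact Ioo_subset_Icc_self ht
    · by_cases hzA : z ∈ A
      · rw [hval₁ z hz hzA]
        exact ⟨le_rfl, hαβ.le⟩
      · rw [hval₂ z hz hzA]
        exact ⟨hαβ.le, le_rfl⟩
  · intro z hz'
    by_cases hz : z ∈ ψ '' Ioo α β
    · obtain ⟨t, ht, rfl⟩ := hz
      rw [hJval t (Ioo_subset_Icc_self ht)]
    · by_cases hzA : z ∈ A
      · rw [hval₁ z hz hzA] at hz'
        exact absurd hz'.1 (lt_irrefl _)
      · rw [hval₂ z hz hzA] at hz'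
        exact absurd hz'.2 (lt_irrefl _)

end Separation

section EdgesOfGraph

variable {G : Type*} [MetricSpace G] {V : Set G}

theorem connectedComponentIn_closure_inter_subset {X : Type*} [TopologicalSpace X] (F : Set X)
    (x : X) : closure (connectedComponentIn F x) ∩ F ⊆ connectedComponentIn F x := by
  by_cases hx : x ∈ F
  · refine IsPreconnected.subset_connectedComponentIn ?_
      ⟨subset_closure (mem_connectedComponentIn hx), hx⟩ inter_subset_right
    exact isPreconnected_connectedComponentIn.subset_closure
      (subset_inter subset_closure (connectedComponentIn_subset F x)) inter_subset_left
  · simp [connectedComponentIn_eq_empty hx]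

/-- A path all of whose accumulation points at an end lie in a finite set converges there. -/
theorem exists_tendsto_of_mapClusterPt_mem_finite [CompactSpace G] (hV : V.Finite) {φ : ℝ → G}
    (hφ : ContinuousOn φ (Ioo 0 1)) {e : ℝ} (he : e ∈ Icc (0 : ℝ) 1)
    (hcl : ∀ z, MapClusterPt z (𝓝[Ioo 0 1] e) φ → z ∈ V) :
    ∃ v ∈ V, Tendsto φ (𝓝[Ioo 0 1] e) (𝓝 v) := by
  have : (𝓝[Ioo (0 : ℝ) 1] e).NeBot := by
    rw [← mem_closure_iff_nhdsWithin_neBot, closure_Ioo zero_ne_one]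
    exact he
  obtain ⟨v, hv⟩ := exists_clusterPt_of_compactSpace (map φ (𝓝[Ioo (0 : ℝ) 1] e))
  have hv' : MapClusterPt v (𝓝[Ioo (0 : ℝ) 1] e) φ := hv
  refine ⟨v, hcl v hv, ?_⟩
  rw [Metric.tendsto_nhds]
  intro ε hε
  obtain ⟨r, hr, hrV⟩ : ∃ r ∈ Ioo 0 ε, r ∉ (fun w ↦ dist w v) '' V :=
    ((Ioo_infinite hε).sdiff (hV.image _)).nonempty
  have hK : IsCompact (Metric.sphere v r) := Metric.isClosed_sphere.isCompact
  have hne : ∀ᶠ t in 𝓝[Ioo (0 : ℝ) 1] e, φ t ∉ Metric.sphere v r := by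
    by_contra hfreq
    obtain ⟨z, hz, hzc⟩ := hK.exists_mapClusterPt_of_frequently (not_eventually.1 hfreq |>.mono
      fun t ht ↦ not_not.1 ht)
    exact hrV ⟨z, hcl z hzc, hz⟩
  obtain ⟨δ, hδ, hball⟩ := Metric.mem_nhdsWithin_iff.1 hne
  have hU : Metric.ball e δ ∩ Ioo 0 1 ∈ 𝓝[Ioo (0 : ℝ) 1] e :=
    inter_mem (mem_nhdsWithin_of_mem_nhds (Metric.ball_mem_nhds e hδ)) self_mem_nhdsWithin
  have hpre : IsPreconnected (Metric.ball e δ ∩ Ioo (0 : ℝ) 1) := by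
    rw [Real.ball_eq_Ioo]
    exact (ordConnected_Ioo.inter ordConnected_Ioo).isPreconnected
  obtain ⟨t₀, ht₀, ht₀U⟩ :=
    ((hv'.frequently (Metric.ball_mem_nhds v hr.1)).and_eventually hU).exists
  filter_upwards [hU] with t ht
  refine lt_trans ?_ hr.2
  by_contra! hle
  have hcont : ContinuousOn (fun t ↦ dist (φ t) v) (Metric.ball e δ ∩ Ioo 0 1) := by
    have := hφ.mono (inter_subset_right : Metric.ball e δ ∩ Ioo 0 1 ⊆ _)
    fun_prop
  obtain ⟨u, hu, hur⟩ := hpre.intermediate_value ht₀U ht hcont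
    ⟨(Metric.mem_ball.1 ht₀).le, hle⟩
  exact hball hu hur

theorem IsTopGraph.exists_edge_path (hG : IsTopGraph V) {x : G} (hx : x ∉ V) :
    ∃ ψ : ℝ → G, ContinuousOn ψ (Icc 0 1) ∧ InjOn ψ (Icc 0 1) ∧
      ψ '' Ioo 0 1 = connectedComponentIn Vᶜ x ∧ ψ 0 ∈ V ∧ ψ 1 ∈ V := by
  have := hG.compact
  set A := connectedComponentIn Vᶜ x with hA
  have hAV : A ⊆ Vᶜ := connectedComponentIn_subset _ _
  obtain ⟨g⟩ := hG.component_openArc x hx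
  classical
  set φ : ℝ → G := fun t ↦ if ht : t ∈ Ioo (0 : ℝ) 1 then (g.symm ⟨t, ht⟩ : G) else x with hφdef
  have hφ : ∀ t (ht : t ∈ Ioo (0 : ℝ) 1), φ t = g.symm ⟨t, ht⟩ := fun t ht ↦ dif_pos ht
  have hφc : ContinuousOn φ (Ioo 0 1) := by
    rw [continuousOn_iff_continuous_domRestrict]
    have : (Ioo (0 : ℝ) 1).domRestrict φ = fun t ↦ (g.symm t : G) := by
      ext t
      exact hφ t t.2
    rw [this]
    fun_prop
  have hφi : InjOn φ (Ioo 0 1) := by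
    intro s hs t ht hst
    rw [hφ s hs, hφ t ht] at hst
    exact congrArg Subtype.val (g.symm.injective (Subtype.ext hst))
  have hφA : φ '' Ioo 0 1 = A := by
    ext z
    constructor
    · rintro ⟨t, ht, rfl⟩
      rw [hφ t ht]
      exact Subtype.coe_prop _
    · intro hz
      exact ⟨g ⟨z, hz⟩, (g ⟨z, hz⟩).2, by rw [hφ _ (g ⟨z, hz⟩).2]; simp⟩
  have hends : ∀ e ∈ Icc (0 : ℝ) 1, e ∉ Ioo (0 : ℝ) 1 →
      ∃ v ∈ V, Tendsto φ (𝓝[Ioo 0 1] e) (𝓝 v) := by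
    intro e he heI
    refine exists_tendsto_of_mapClusterPt_mem_finite hG.finite_vertexSet hφc he fun z hz ↦ ?_
    by_contra hzV
    have hev : ∀ᶠ t in 𝓝[Ioo (0 : ℝ) 1] e, φ t ∈ A := by
      filter_upwards [self_mem_nhdsWithin] with t ht
      exact hφA ▸ mem_image_of_mem φ ht
    have hzA : z ∈ A := by
      refine connectedComponentIn_closure_inter_subset Vᶜ x ⟨?_, hzV⟩
      rw [mem_closure_iff_nhds]
      intro U hU
      obtain ⟨t, ht, ht'⟩ := ((hz.frequently hU).and_eventually hev).exists
      exact ⟨φ t, ht, ht'⟩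
    have hgz : (g ⟨z, hzA⟩ : ℝ) ≠ e := fun h ↦ heI (h ▸ (g ⟨z, hzA⟩).2)
    obtain ⟨U₁, U₂, hU₁, hU₂, hz₁, he₂, hdisj⟩ := t2_separation hgz
    have hgc : Continuous fun w : A ↦ (g w : ℝ) := by fun_prop
    obtain ⟨W, hW, hWeq⟩ := isOpen_induced_iff.1 (hU₁.preimage hgc)
    have hzW : z ∈ W := by
      have : (⟨z, hzA⟩ : A) ∈ Subtype.val ⁻¹' W := by rw [hWeq]; exact hz₁
      exact this
    obtain ⟨t, htW, ht, htU⟩ := ((hz.frequently (hW.mem_nhds hzW)).and_eventually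
      (eventually_mem_nhdsWithin.and
        (mem_nhdsWithin_of_mem_nhds (hU₂.mem_nhds he₂)))).exists
    rw [hφ t ht] at htW
    have : g.symm ⟨t, ht⟩ ∈ (fun w : A ↦ (g w : ℝ)) ⁻¹' U₁ := by rw [← hWeq]; exact htW
    exact disjoint_left.1 hdisj (by simpa using this) htU
  have hclI : closure (Ioo (0 : ℝ) 1) = Icc 0 1 := closure_Ioo zero_ne_one
  set ψ := extendFrom (Ioo (0 : ℝ) 1) φ with hψdef
  have hψφ : ∀ t ∈ Ioo (0 : ℝ) 1, ψ t = φ t := extendFrom_extends hφc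
  have hψc : ContinuousOn ψ (Icc 0 1) := by
    refine continuousOn_extendFrom hclI.ge fun t ht ↦ ?_
    by_cases h : t ∈ Ioo (0 : ℝ) 1
    · exact ⟨_, hφc t h⟩
    · obtain ⟨v, -, hv⟩ := hends t ht h
      exact ⟨v, hv⟩
  have hψV : ∀ e ∈ Icc (0 : ℝ) 1, e ∉ Ioo (0 : ℝ) 1 → ψ e ∈ V := by
    intro e he heI
    obtain ⟨v, hv, hlim⟩ := hends e he heI
    rwa [hψdef, extendFrom_eq (hclI ▸ he) hlim]
  have h0 : ψ 0 ∈ V := hψV 0 (by simp) (by simp)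
  have h1 : ψ 1 ∈ V := hψV 1 (by simp) (by simp)
  have himg : ψ '' Ioo 0 1 = A := (image_congr hψφ).trans hφA
  have hnotV : ∀ t ∈ Ioo (0 : ℝ) 1, ψ t ∉ V := fun t ht ↦ hAV (himg ▸ mem_image_of_mem ψ ht)
  have hψi : InjOn ψ (Ioo 0 1) := hφi.congr fun t ht ↦ (hψφ t ht).symm
  have hcases : ∀ t ∈ Icc (0 : ℝ) 1, t = 0 ∨ t = 1 ∨ t ∈ Ioo (0 : ℝ) 1 := by
    intro t ht
    by_contra! h
    exact h.2.2 ⟨ht.1.lt_of_ne' h.1, ht.2.lt_of_ne h.2.1⟩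
  have hne : ψ 0 ≠ ψ 1 := by
    intro heq
    have hico : InjOn ψ (Ico 0 1) := by
      intro s hs t ht hst
      rcases hs.1.eq_or_lt with rfl | hs' <;> rcases ht.1.eq_or_lt with rfl | ht'
      · rfl
      · exact absurd (hst ▸ h0) (hnotV t ⟨ht', ht.2⟩)
      · exact absurd (hst ▸ h0) (hnotV s ⟨hs', hs.2⟩)
      · exact hψi ⟨hs', hs.2⟩ ⟨ht', ht.2⟩ hst
    have h3 := hG.circle_vertices _ (isCircle_image_Icc one_pos hψc hico heq)
    have hsub : ψ '' Icc 0 1 ∩ V ⊆ {ψ 0} := by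
      rintro _ ⟨⟨t, ht, rfl⟩, htV⟩
      rcases hcases t ht with rfl | rfl | h
      · rfl
      · exact heq.symm
      · exact absurd htV (hnotV t h)
    have := ncard_le_ncard hsub (finite_singleton _)
    rw [ncard_singleton] at this
    omega
  refine ⟨ψ, hψc, ?_, himg, h0, h1⟩
  intro s hs t ht hst
  rcases hcases s hs with rfl | rfl | hs' <;> rcases hcases t ht with rfl | rfl | ht'
  · rfl
  · exact absurd hst hne
  · exact absurd (hst ▸ h0) (hnotV t ht')
  · exact absurd hst.symm hne
  · rfl
  · exact absurd (hst ▸ h1) (hnotV t ht')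
  · exact absurd (hst ▸ h0) (hnotV s hs')
  · exact absurd (hst ▸ h1) (hnotV s hs')
  · exact hψi hs' ht' hst

theorem IsTopGraph.exists_finite_edgeCharts (hG : IsTopGraph V) :
    ∃ Ψ : Set (ℝ → G), Ψ.Finite ∧ (∀ ψ ∈ Ψ, IsEdgeChart V ψ) ∧
      ∀ x ∉ V, ∃ ψ ∈ Ψ, x ∈ ψ '' Ioo 0 1 := by
  have key : ∀ A : Set G, (∃ x ∉ V, connectedComponentIn Vᶜ x = A) → ∃ ψ : ℝ → G,
      ContinuousOn ψ (Icc 0 1) ∧ InjOn ψ (Icc 0 1) ∧ ψ '' Ioo 0 1 = A ∧ ψ 0 ∈ V ∧ ψ 1 ∈ V := by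
    rintro _ ⟨x, hx, rfl⟩
    exact hG.exists_edge_path hx
  have := hG.nontrivial
  choose! ψ hc hi himg h0 h1 using key
  set E : Set (Set G) := {A | ∃ x ∉ V, connectedComponentIn Vᶜ x = A} with hE
  have hEV : ∀ A ∈ E, A ⊆ Vᶜ := by
    rintro _ ⟨x, -, rfl⟩
    exact connectedComponentIn_subset _ _
  have hdisj : ∀ A ∈ E, ∀ B ∈ E, ∀ z, z ∈ A → z ∈ B → A = B := by
    rintro _ ⟨x, -, rfl⟩ _ ⟨y, -, rfl⟩ z hzx hzy
    rw [connectedComponentIn_eq hzx, connectedComponentIn_eq hzy]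
  have hnotV : ∀ A ∈ E, ∀ t ∈ Ioo (0 : ℝ) 1, ψ A t ∉ V := fun A hA t ht ↦
    hEV A hA ((himg A hA).subset (mem_image_of_mem _ ht))
  have hcases : ∀ t ∈ Icc (0 : ℝ) 1, t = 0 ∨ t = 1 ∨ t ∈ Ioo (0 : ℝ) 1 := by
    intro t ht
    by_contra! h
    exact h.2.2 ⟨ht.1.lt_of_ne' h.1, ht.2.lt_of_ne h.2.1⟩
  have hEfin : E.Finite := by
    refine Set.Finite.of_finite_image (f := fun A ↦ (ψ A 0, ψ A 1))
      ((hG.finite_vertexSet.prod hG.finite_vertexSet).subset ?_) ?_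
    · rintro _ ⟨A, hA, rfl⟩
      exact ⟨h0 A hA, h1 A hA⟩
    · intro A hA B hB hAB
      by_contra hne
      obtain ⟨e0, e1⟩ := Prod.mk.inj hAB
      have hmaps : MapsTo (fun t : ℝ ↦ 1 - t) (Icc 0 1) (Icc 0 1) := by
        intro t ht
        constructor <;> linarith [ht.1, ht.2]
      have hcirc := isCircle_union_arcs (γ := ψ A) (δ := fun t ↦ ψ B (1 - t)) one_pos one_pos
        (hc A hA) ((hc B hB).comp (by fun_prop) hmaps) (hi A hA)
        ((hi B hB).comp sub_right_injective.injOn hmaps) (by simpa using e1)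
        (by simpa using e0.symm) (by
          intro t ht u hu htu
          rcases hcases u hu with h | h | hu'
          · exact Or.inl h
          · exact Or.inr h
          · have hu'' : 1 - u ∈ Ioo (0 : ℝ) 1 := ⟨by linarith [hu'.2], by linarith [hu'.1]⟩
            have hB' := hnotV B hB _ hu''
            rw [← htu] at hB'
            rcases hcases t ht with rfl | rfl | ht'
            · exact absurd (h0 A hA) hB'
            · exact absurd (h1 A hA) hB'
            · refine absurd (hdisj A hA B hB (ψ A t) ?_ ?_) hne
              · exact (himg A hA).subset (mem_image_of_mem _ ht')
              · rw [htu]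
                exact (himg B hB).subset (mem_image_of_mem _ hu''))
      have h3 := hG.circle_vertices _ hcirc
      have hsub : (ψ A '' Icc 0 1 ∪ (fun t ↦ ψ B (1 - t)) '' Icc 0 1) ∩ V ⊆
          {ψ A 0, ψ A 1} := by
        rintro _ ⟨⟨t, ht, rfl⟩ | ⟨t, ht, rfl⟩, htV⟩
        · rcases hcases t ht with rfl | rfl | h
          · exact Or.inl rfl
          · exact Or.inr rfl
          · exact absurd htV (hnotV A hA t h)
        · rcases hcases _ (hmaps ht) with h | h | h
          · exact Or.inl ((congrArg (ψ B) h).trans e0.symm)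
          · exact Or.inr ((congrArg (ψ B) h).trans e1.symm)
          · exact absurd htV (hnotV B hB _ h)
      have := ncard_le_ncard hsub (by simp)
      have := ncard_insert_le (ψ A 0) {ψ A 1}
      rw [ncard_singleton] at this
      omega
  have hmem : ∀ x ∉ V, connectedComponentIn Vᶜ x ∈ E := fun x hx ↦ ⟨x, hx, rfl⟩
  refine ⟨ψ '' E, hEfin.image ψ, ?_, fun x hx ↦ ⟨_, mem_image_of_mem ψ (hmem x hx), ?_⟩⟩
  · rintro _ ⟨A, hA, rfl⟩
    refine ⟨hc A hA, hi A hA, ?_, hnotV A hA⟩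
    have hcl : IsClosed (V ∪ ⋃ B ∈ E \ {A}, ψ B '' Icc 0 1) :=
      hG.finite_vertexSet.isClosed.union ((hEfin.subset sdiff_subset).isClosed_biUnion
        fun B hB ↦ (isCompact_Icc.image_of_continuousOn (hc B hB.1)).isClosed)
    have hAeq : ψ A '' Ioo 0 1 = (V ∪ ⋃ B ∈ E \ {A}, ψ B '' Icc 0 1)ᶜ := by
      rw [himg A hA]
      ext z
      constructor
      · rintro hzA (hzV | hz)
        · exact hEV A hA hzA hzV
        · simp only [mem_iUnion] at hz
          obtain ⟨B, ⟨hB, hBA⟩, t, ht, rfl⟩ := hz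
          rcases hcases t ht with rfl | rfl | ht'
          · exact hEV A hA hzA (h0 B hB)
          · exact hEV A hA hzA (h1 B hB)
          · exact hBA (hdisj B hB A hA _ ((himg B hB).subset (mem_image_of_mem _ ht')) hzA)
      · intro hz
        have hzV : z ∉ V := fun h ↦ hz (Or.inl h)
        have hzc := mem_connectedComponentIn (F := Vᶜ) hzV
        by_contra hzA
        refine hz (Or.inr (mem_biUnion (x := connectedComponentIn Vᶜ z)
          ⟨hmem z hzV, fun e ↦ hzA (by rw [mem_singleton_iff] at e; rwa [← e])⟩ ?_))
        rw [← himg _ (hmem z hzV)] at hzc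
        exact image_mono Ioo_subset_Icc_self hzc
    rw [hAeq]
    exact hcl.isOpen_compl
  · rw [himg _ (hmem x hx)]
    exact mem_connectedComponentIn (F := Vᶜ) hx

end EdgesOfGraph

section Recurrence

variable {X : Type*} [TopologicalSpace X] {f : X → X} {x : X}

theorem exists_iterate_mem_of_mem_recurrentPts (hx : x ∈ recurrentPts f) {U : Set X}
    (hU : U ∈ 𝓝 x) (N : ℕ) : ∃ n ≥ N, f^[n] x ∈ U := by
  obtain ⟨_, hy, n, rfl⟩ := mem_closure_iff_nhds.1 (mem_iInter.1 hx N) U hU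
  exact ⟨n + N, Nat.le_add_left _ _, hy⟩

theorem iterate_mem_recurrentPts (hf : Continuous f) (hx : x ∈ recurrentPts f) (n : ℕ) :
    f^[n] x ∈ recurrentPts f := by
  refine mem_iInter.2 fun N ↦ mem_closure_iff_nhds.2 fun U hU ↦ ?_
  obtain ⟨k, hk, hkU⟩ := exists_iterate_mem_of_mem_recurrentPts hx
    ((hf.iterate n).continuousAt.preimage_mem_nhds hU) N
  refine ⟨f^[n] (f^[k] x), hkU, k - N, ?_⟩
  simp only
  rw [Nat.sub_add_cancel hk, ← iterate_add_apply, ← iterate_add_apply, add_comm]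

theorem periodicPts_subset_recurrentPts : periodicPts f ⊆ recurrentPts f := by
  rintro x ⟨k, hk, hx⟩
  refine mem_iInter.2 fun N ↦ subset_closure ⟨k * N - N, ?_⟩
  simp only
  rw [Nat.sub_add_cancel (Nat.le_mul_of_pos_left N hk)]
  exact hx.mul_const N

theorem mapsTo_closure_periodicPts (hf : Continuous f) :
    MapsTo f (closure (periodicPts f)) (closure (periodicPts f)) :=
  (bijOn_periodicPts f).mapsTo.closure hf

theorem mem_of_iterate_mem_of_mem_recurrentPts {D : Set X} (hD : IsClosed D)
    (hfD : MapsTo f D D) (hx : x ∈ recurrentPts f) {n : ℕ} (hn : f^[n] x ∈ D) : x ∈ D := by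
  refine closure_minimal ?_ hD (mem_iInter.1 hx n)
  rintro _ ⟨k, rfl⟩
  simp only
  rw [iterate_add_apply]
  exact hfD.iterate k hn

/-- The orbit of a recurrent point which is not a limit of periodic points has no repetition. -/
theorem injective_iterate_of_mem_recurrentPts (hf : Continuous f) (hx : x ∈ recurrentPts f)
    (hxP : x ∉ closure (periodicPts f)) : Injective fun n ↦ f^[n] x := by
  refine Injective.of_lt_imp_ne fun i j hij h ↦ hxP ?_
  refine mem_of_iterate_mem_of_mem_recurrentPts isClosed_closure (mapsTo_closure_periodicPts hf)
    hx (n := i) (subset_closure ⟨j - i, Nat.sub_pos_of_lt hij, ?_⟩)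
  rw [IsPeriodicPt, IsFixedPt, ← iterate_add_apply, Nat.sub_add_cancel hij.le]
  exact h.symm

/-- If the recurrent points outside `closure (periodicPts f)` are dense at `z`, so are those
which moreover avoid a finite set. -/
theorem mem_closure_recurrentPts_diff [T1Space X] (hf : Continuous f) {V : Set X} (hV : V.Finite)
    {z : X} (hz : z ∈ closure (recurrentPts f)) (hzP : z ∉ closure (periodicPts f)) :
    z ∈ closure (recurrentPts f \ (closure (periodicPts f) ∪ V)) := by
  rw [mem_closure_iff_nhds]
  intro U hU
  obtain ⟨r, ⟨hrU, hrP⟩, hr⟩ := mem_closure_iff.1 hz _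
    (isOpen_interior.sdiff isClosed_closure) ⟨mem_interior_iff_mem_nhds.2 hU, hzP⟩
  have hfin := hV.preimage (injective_iterate_of_mem_recurrentPts hf hr hrP).injOn
  obtain ⟨N, hN⟩ := hfin.bddAbove
  obtain ⟨n, hn, hnU⟩ := exists_iterate_mem_of_mem_recurrentPts hr
    (isOpen_interior.mem_nhds hrU) (N + 1)
  refine ⟨f^[n] r, interior_subset hnU, iterate_mem_recurrentPts hf hr n, ?_⟩
  rintro (h | h)
  · exact hrP (mem_of_iterate_mem_of_mem_recurrentPts isClosed_closure
      (mapsTo_closure_periodicPts hf) hr h)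
  · have : n ≤ N := hN h
    omega

end Recurrence

section IntervalReturns

/-! A family `F` of partially composable functions on an interval: `F (k + l) t = F l (F k t)`
whenever `F k t` is an interior point. -/

variable {α β : ℝ} {F : ℕ → ℝ → ℝ}

theorem lt_apply_mul_of_lt (hc : ∀ k, ContinuousOn (F k) (Icc α β))
    (hF : ∀ k l, ∀ t ∈ Ioo α β, F k t ∈ Ioo α β → F (k + l) t = F l (F k t))
    (hfix : ∀ k ≥ 1, ∀ t ∈ Ioo α β, F k t ≠ t) {t : ℝ} (ht : t ∈ Ioo α β) {m : ℕ} (hm : 1 ≤ m)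
    (hmt : F m t ∈ Ioo α β) (hlt : t < F m t) {j : ℕ} (hj : 1 ≤ j) : t < F (m * j) t := by
  induction j, hj using Nat.le_induction with
  | base => simpa using hlt
  | succ j hj ih =>
    by_contra! hle
    rw [mul_add_one, add_comm, hF m _ t ht hmt] at hle
    have hsub : uIcc t (F m t) ⊆ Ioo α β := ordConnected_Ioo.uIcc_subset ht hmt
    obtain ⟨c, hcm, hcf⟩ := exists_mem_uIcc_isFixedPt
      ((hc (m * j)).mono (hsub.trans Ioo_subset_Icc_self)) ih.le (hle.trans hlt.le)
    exact hfix _ (Nat.mul_pos hm hj) c (hsub hcm) hcf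

theorem apply_mul_lt_of_lt (hc : ∀ k, ContinuousOn (F k) (Icc α β))
    (hF : ∀ k l, ∀ t ∈ Ioo α β, F k t ∈ Ioo α β → F (k + l) t = F l (F k t))
    (hfix : ∀ k ≥ 1, ∀ t ∈ Ioo α β, F k t ≠ t) {t : ℝ} (ht : t ∈ Ioo α β) {m : ℕ} (hm : 1 ≤ m)
    (hmt : F m t ∈ Ioo α β) (hlt : F m t < t) {j : ℕ} (hj : 1 ≤ j) : F (m * j) t < t := by
  induction j, hj using Nat.le_induction with
  | base => simpa using hlt
  | succ j hj ih =>
    by_contra! hle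
    rw [mul_add_one, add_comm, hF m _ t ht hmt] at hle
    have hsub : uIcc (F m t) t ⊆ Ioo α β := ordConnected_Ioo.uIcc_subset hmt ht
    obtain ⟨c, hcm, hcf⟩ := exists_mem_uIcc_isFixedPt
      ((hc (m * j)).mono (hsub.trans Ioo_subset_Icc_self)) (hlt.le.trans hle) ih.le
    exact hfix _ (Nat.mul_pos hm hj) c (hsub hcm) hcf

theorem not_lt_and_lt_of_forall_ne (hc : ∀ k, ContinuousOn (F k) (Icc α β))
    (hF : ∀ k l, ∀ t ∈ Ioo α β, F k t ∈ Ioo α β → F (k + l) t = F l (F k t))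
    (hfix : ∀ k ≥ 1, ∀ t ∈ Ioo α β, F k t ≠ t) {t u : ℝ} (ht : t ∈ Ioo α β) (hu : u ∈ Ioo α β)
    {m n : ℕ} (hm : 1 ≤ m) (hn : 1 ≤ n) (hmt : F m t ∈ Ioo α β) (hnu : F n u ∈ Ioo α β)
    (hlt : t < F m t) : u < F n u := by
  by_contra! hle
  have h₁ := lt_apply_mul_of_lt hc hF hfix ht hm hmt hlt hn
  have h₂ := apply_mul_lt_of_lt hc hF hfix hu hn hnu (hle.lt_of_ne (hfix n hn u hu)) hm
  rw [mul_comm] at h₂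
  have hsub : uIcc t u ⊆ Ioo α β := ordConnected_Ioo.uIcc_subset ht hu
  obtain ⟨c, hcm, hcf⟩ := exists_mem_uIcc_isFixedPt
    ((hc (m * n)).mono (hsub.trans Ioo_subset_Icc_self)) h₁.le h₂.le
  exact hfix _ (Nat.mul_pos hm hn) c (hsub hcm) hcf

theorem exists_apply_eq_of_returns (hc : ∀ k, ContinuousOn (F k) (Icc α β))
    (hF : ∀ k l, ∀ t ∈ Ioo α β, F k t ∈ Ioo α β → F (k + l) t = F l (F k t)) {τ : ℝ}
    (hτ : τ ∈ Ioo α β) (hret : ∀ U ∈ 𝓝 τ, ∀ N, ∃ n ≥ N, F n τ ∈ U) :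
    ∃ k ≥ 1, ∃ t ∈ Ioo α β, F k t = t := by
  by_contra! hfix
  obtain ⟨k, hk, hkI⟩ := hret (Ioo α β) (isOpen_Ioo.mem_nhds hτ) 1
  obtain ⟨n, hn, hnI, hnk⟩ := hret (Ioo α β ∩ Metric.ball τ |F k τ - τ|)
    (inter_mem (isOpen_Ioo.mem_nhds hτ)
      (Metric.ball_mem_nhds _ (abs_pos.2 (sub_ne_zero.2 (hfix k hk τ hτ))))) (k + 1)
  rw [Metric.mem_ball, Real.dist_eq] at hnk
  have hnk' : F (n - k) (F k τ) = F n τ := by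
    rw [← hF k _ τ hτ hkI, Nat.add_sub_cancel' (by omega)]
  have hn₁ : 1 ≤ n - k := by omega
  rcases (hfix k hk τ hτ).lt_or_gt with h | h
  · have h' : F k τ < F (n - k) (F k τ) := by
      rw [hnk']
      rw [abs_of_neg (sub_neg.2 h)] at hnk
      linarith [(abs_lt.1 hnk).1]
    exact h.not_gt (not_lt_and_lt_of_forall_ne hc hF hfix hkI hτ hn₁ hk (hnk' ▸ hnI) hkI h')
  · have h' := not_lt_and_lt_of_forall_ne hc hF hfix hτ hkI hk hn₁ hkI (hnk' ▸ hnI) h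
    rw [hnk'] at h'
    rw [abs_of_pos (sub_pos.2 h)] at hnk
    linarith [(abs_lt.1 hnk).2]

end IntervalReturns

section ArcReturns

theorem exists_first_exit {X : Type*} [TopologicalSpace X] {g : ℝ → X} {τ s : ℝ}
    (hg : ContinuousOn g (uIcc τ s)) {U : Set X} (hU : IsOpen U) (hτ : g τ ∈ U) (hs : g s ∉ U) :
    ∃ t ∈ uIcc τ s, (∀ u ∈ uIcc τ t, g u ∈ closure U) ∧ g t ∉ U := by
  have hK : IsCompact (uIcc τ s ∩ g ⁻¹' Uᶜ) :=
    isCompact_uIcc.of_isClosed_subset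
      (hg.preimage_isClosed_of_isClosed isClosed_Icc hU.isClosed_compl) inter_subset_left
  obtain ⟨t, ⟨ht, htU⟩, hmin⟩ := hK.exists_isMinOn ⟨s, right_mem_uIcc, hs⟩
    (f := fun t ↦ |t - τ|) (by fun_prop)
  have hsub : uIcc τ t ⊆ uIcc τ s := uIcc_subset_uIcc_left ht
  have hin : ∀ u ∈ uIcc τ t, u ≠ t → g u ∈ U := by
    intro u hu hne
    by_contra huU
    have h₁ : |t - τ| ≤ |u - τ| := hmin ⟨hsub hu, huU⟩
    rcases le_total τ t with h | h
    · rw [uIcc_of_le h] at hu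
      rw [abs_of_nonneg (by linarith), abs_of_nonneg (by linarith [hu.1])] at h₁
      exact hne (le_antisymm hu.2 (by linarith))
    · rw [uIcc_of_ge h] at hu
      rw [abs_of_nonpos (by linarith), abs_of_nonpos (by linarith [hu.2])] at h₁
      exact hne (le_antisymm (by linarith) hu.1)
  have hτt : τ ≠ t := fun h ↦ htU (h ▸ hτ)
  refine ⟨t, ht, fun u hu ↦ ?_, htU⟩
  by_cases hut : u = t
  · subst hut
    have hacc := isPreconnected_uIcc.preperfect_of_nontrivial
      ⟨τ, left_mem_uIcc, u, right_mem_uIcc, hτt⟩ u hu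
    have hcl : u ∈ closure (uIcc τ u \ {u}) := by
      rw [mem_closure_iff_clusterPt]
      exact accPt_principal_iff_clusterPt.1 hacc
    refine closure_mono ?_ (((hg u ht).mono (sdiff_subset.trans hsub)).mem_closure_image hcl)
    rintro _ ⟨v, hv, rfl⟩
    exact hin v hv.1 hv.2
  · exact subset_closure (hin u hu hut)

variable {G : Type*} [TopologicalSpace G] [T2Space G] {f : G → G} {ψ : ℝ → G} {α β : ℝ}

/-- A map from a subarc of an arc to the arc which moves the ends in opposite directions has a
fixed point. -/
theorem exists_fixed_of_arc {g : G → G} (hg : Continuous g) (hc : ContinuousOn ψ (Icc α β))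
    (hi : InjOn ψ (Icc α β)) {a b a' b' : ℝ} (hab : uIcc a b ⊆ Icc α β)
    (hmaps : ∀ t ∈ uIcc a b, g (ψ t) ∈ ψ '' Icc α β) (ha' : a' ∈ Icc α β) (hb' : b' ∈ Icc α β)
    (ha : g (ψ a) = ψ a') (hb : g (ψ b) = ψ b') (haa' : a ≤ a') (hbb' : b' ≤ b) :
    ∃ c ∈ uIcc a b, g (ψ c) = ψ c := by
  obtain ⟨ρ, hρc, hρ⟩ := exists_continuousOn_leftInvOn isCompact_Icc hc hi
  have hcont : ContinuousOn (fun t ↦ ρ (g (ψ t))) (uIcc a b) :=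
    hρc.comp (hg.comp_continuousOn (hc.mono hab)) hmaps
  obtain ⟨c, hcm, hcf⟩ := exists_mem_uIcc_isFixedPt hcont
    (by simp only [ha, hρ a' ha', haa']) (by simp only [hb, hρ b' hb', hbb'])
  refine ⟨c, hcm, ?_⟩
  obtain ⟨d, hd, hdc⟩ := hmaps c hcm
  have hcf' : ρ (g (ψ c)) = c := hcf
  rw [← hdc, hρ d hd] at hcf'
  rw [← hdc, hcf']

/-- A point returning from the right to an arc without periodic points is not a limit of points
of the arc which are eventually mapped out of the arc. -/
theorem false_of_returns_right (hf : Continuous f) (hc : ContinuousOn ψ (Icc α β))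
    (hi : InjOn ψ (Icc α β)) (hopen : IsOpen (ψ '' Ioo α β)) {D : Set G} (hfD : MapsTo f D D)
    (hPD : periodicPts f ⊆ D) (hJ : ψ '' Icc α β ⊆ Dᶜ) {τ : ℝ} (hτ : τ ∈ Ioo α β)
    (hE : ∀ δ > 0, ∃ s ∈ Icc α β, |s - τ| < δ ∧ ∃ n, f^[n] (ψ s) ∈ D)
    (hret : ∀ u > τ, ∀ N, ∃ n ≥ N, ∃ w ∈ Ioo τ u, f^[n] (ψ τ) = ψ w) : False := by
  have hτI : τ ∈ Icc α β := Ioo_subset_Icc_self hτ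
  have hnofix : ∀ k ≥ 1, ∀ c ∈ Icc α β, f^[k] (ψ c) ≠ ψ c := fun k hk c hcI h ↦
    hJ ⟨c, hcI, rfl⟩ (hPD ⟨k, hk, h⟩)
  obtain ⟨m, -, u, hu, hmu⟩ := hret β hτ.2 0
  have huI : u ∈ Ioo α β := ⟨hτ.1.trans hu.1, hu.2⟩
  obtain ⟨δ, hδ, hδm⟩ : ∃ δ > 0, ∀ s ∈ Icc α β, |s - τ| < δ → f^[m] (ψ s) ∈ ψ '' Ioo α β := by
    have hcm : ContinuousOn (fun s ↦ f^[m] (ψ s)) (Icc α β) :=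
      (hf.iterate m).comp_continuousOn hc
    have := hcm τ hτI (hopen.mem_nhds (by simp only [hmu]; exact mem_image_of_mem ψ huI))
    obtain ⟨δ, hδ, h⟩ := Metric.mem_nhdsWithin_iff.1 this
    exact ⟨δ, hδ, fun s hs hsδ ↦ h ⟨hsδ, hs⟩⟩
  obtain ⟨s, hs, hsδ, N, hN⟩ := hE δ hδ
  obtain ⟨n, hn, w, hw, hnw⟩ := hret u hu.1 (max N (m + 1))
  have hnN : N ≤ n := (le_max_left _ _).trans hn
  have hnm : m + 1 ≤ n := (le_max_right _ _).trans hn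
  have hwI : w ∈ Ioo α β := ⟨hτ.1.trans hw.1, hw.2.trans hu.2⟩
  have hτs : uIcc τ s ⊆ Icc α β := ordConnected_Icc.uIcc_subset hτI hs
  have hJclosed : IsClosed (ψ '' Icc α β) := (isCompact_Icc.image_of_continuousOn hc).isClosed
  have hnD : f^[n] (ψ s) ∈ D := by
    rw [← Nat.sub_add_cancel hnN, iterate_add_apply]
    exact hfD.iterate _ hN
  obtain ⟨t, ht, htJ, htn⟩ := exists_first_exit
    (g := fun r ↦ f^[n] (ψ r)) ((hf.iterate n).comp_continuousOn (hc.mono hτs)) hopen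
    (by simp only [hnw]; exact mem_image_of_mem ψ hwI)
    (fun h ↦ hJ (image_mono Ioo_subset_Icc_self h) hnD)
  replace htJ : ∀ r ∈ uIcc τ t, f^[n] (ψ r) ∈ ψ '' Icc α β := fun r hr ↦
    closure_minimal (image_mono Ioo_subset_Icc_self) hJclosed (htJ r hr)
  have hτt : uIcc τ t ⊆ uIcc τ s := uIcc_subset_uIcc_left ht
  obtain ⟨b, hb, hbt⟩ := htJ t right_mem_uIcc
  have hbαβ : b = α ∨ b = β := by
    by_contra! h
    exact htn ⟨b, ⟨hb.1.lt_of_ne' h.1, hb.2.lt_of_ne h.2⟩, hbt⟩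
  rcases hbαβ with rfl | rfl
  · obtain ⟨c, hcm, hcf⟩ := exists_fixed_of_arc (hf.iterate n) hc hi (hτt.trans hτs) htJ
      (Ioo_subset_Icc_self hwI) hb hnw hbt.symm hw.1.le (hτs ht).1
    exact hnofix n (by omega) c (hτs (hτt hcm)) hcf
  · obtain ⟨ρ, hρc, hρ⟩ := exists_continuousOn_leftInvOn isCompact_Icc hc hi
    have hmJ : ∀ r ∈ uIcc τ t, f^[m] (ψ r) ∈ ψ '' Icc α b := by
      intro r hr
      refine image_mono Ioo_subset_Icc_self (hδm r (hτs (hτt hr)) (lt_of_le_of_lt ?_ hsδ))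
      exact abs_sub_left_of_mem_uIcc (hτt hr)
    have hQc : ContinuousOn (fun r ↦ ρ (f^[m] (ψ r))) (uIcc τ t) :=
      hρc.comp ((hf.iterate m).comp_continuousOn (hc.mono (hτt.trans hτs))) hmJ
    have hQ : ∀ r ∈ uIcc τ t, ρ (f^[m] (ψ r)) ∈ Icc α b ∧
        ψ (ρ (f^[m] (ψ r))) = f^[m] (ψ r) := by
      intro r hr
      obtain ⟨q, hq, hqr⟩ := hmJ r hr
      rw [← hqr, hρ q hq]
      exact ⟨hq, rfl⟩
    have hQτ : ρ (f^[m] (ψ τ)) = u := by rw [hmu, hρ u (Ioo_subset_Icc_self huI)]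
    set v := ρ (f^[m] (ψ t)) with hv
    have hiter : ∀ r, f^[n - m] (f^[m] (ψ r)) = f^[n] (ψ r) := fun r ↦ by
      rw [← iterate_add_apply, Nat.sub_add_cancel (by omega)]
    have hvI := hQ t right_mem_uIcc
    have huv : uIcc u v ⊆ Icc α b :=
      ordConnected_Icc.uIcc_subset (Ioo_subset_Icc_self huI) hvI.1
    rw [uIcc_comm] at huv
    have hmaps : ∀ y ∈ uIcc v u, f^[n - m] (ψ y) ∈ ψ '' Icc α b := by
      intro y hy
      rw [uIcc_comm, ← hQτ, hv] at hy
      obtain ⟨r, hr, rfl⟩ := intermediate_value_uIcc hQc hy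
      simp only
      rw [(hQ r hr).2, hiter]
      exact htJ r hr
    obtain ⟨c, hcm, hcf⟩ := exists_fixed_of_arc (hf.iterate (n - m)) hc hi huv hmaps hb
      (Ioo_subset_Icc_self hwI) (by rw [hvI.2, hiter, hbt]) (by rw [← hmu, hiter, hnw])
      hvI.1.2 hw.2.le
    exact hnofix (n - m) (by omega) c (huv hcm) hcf

end ArcReturns

section CirclesThroughRecurrentPoints

variable {G : Type*} [MetricSpace G] {V : Set G} {f : G → G}

theorem IsEdgeChart.false_of_returns {ψ : ℝ → G} (hψ : IsEdgeChart V ψ) (hf : Continuous f)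
    {D : Set G} (hfD : MapsTo f D D) (hPD : periodicPts f ⊆ D) {α β τ : ℝ} (hα : 0 ≤ α)
    (hβ : β ≤ 1) (hJ : ψ '' Icc α β ⊆ Dᶜ) (hτ : τ ∈ Ioo α β)
    (hE : ∀ δ > 0, ∃ s ∈ Icc α β, |s - τ| < δ ∧ ∃ n, f^[n] (ψ s) ∈ D)
    (hret : ∀ U ∈ 𝓝 τ, ∀ N, ∃ n ≥ N, ∃ w ∈ U, w ≠ τ ∧ f^[n] (ψ τ) = ψ w) : False := by
  by_cases hright : ∀ u > τ, ∀ N, ∃ n ≥ N, ∃ w ∈ Ioo τ u, f^[n] (ψ τ) = ψ w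
  · have hsub : Icc α β ⊆ Icc 0 1 := Icc_subset_Icc hα hβ
    exact false_of_returns_right hf (hψ.continuousOn.mono hsub) (hψ.injOn.mono hsub)
      (hψ.isOpen_image_Ioo hα hβ) hfD hPD hJ hτ hE hright
  push Not at hright
  obtain ⟨u₀, hu₀, N₀, hN₀⟩ := hright
  have hsub : Icc (1 - β) (1 - α) ⊆ Icc 0 1 := Icc_subset_Icc (by linarith) (by linarith)
  refine false_of_returns_right (τ := 1 - τ) hf (hψ.reverse.continuousOn.mono hsub)
    (hψ.reverse.injOn.mono hsub) (hψ.reverse.isOpen_image_Ioo (by linarith) (by linarith)) hfD hPD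
    ?_ ⟨by linarith [hτ.2], by linarith [hτ.1]⟩ ?_ ?_
  · rintro _ ⟨t, ht, rfl⟩
    exact hJ ⟨1 - t, ⟨by linarith [ht.2], by linarith [ht.1]⟩, rfl⟩
  · intro δ hδ
    obtain ⟨s, hs, hsδ, n, hn⟩ := hE δ hδ
    refine ⟨1 - s, ⟨by linarith [hs.2], by linarith [hs.1]⟩, ?_, n, by simpa using hn⟩
    rwa [sub_sub_sub_cancel_left, abs_sub_comm]
  · intro u hu N
    obtain ⟨n, hn, w, hw, hwτ, hnw⟩ := hret (Ioo (1 - u) u₀)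
      (Ioo_mem_nhds (by linarith) hu₀) (max N N₀)
    refine ⟨n, (le_max_left _ _).trans hn, 1 - w, ⟨?_, by linarith [hw.1]⟩, by simpa using hnw⟩
    rcases hwτ.lt_or_gt with h | h
    · linarith
    · exact absurd hnw (hN₀ n ((le_max_right _ _).trans hn) w ⟨h, hw.2⟩)

theorem exists_isCircle_of_mem_recurrentPts {Ψ : Set (ℝ → G)} (hV : V.Finite) (hΨ : Ψ.Finite)
    (hchart : ∀ ψ ∈ Ψ, IsEdgeChart V ψ) (hcover : ∀ x ∉ V, ∃ ψ ∈ Ψ, x ∈ ψ '' Ioo 0 1)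
    (hf : Continuous f) {x : G} (hx : x ∈ recurrentPts f) (hxP : x ∉ closure (periodicPts f))
    (hxV : x ∉ V) : ∃ C, IsCircle C ∧ x ∈ C ∧ C ⊆ (closure (periodicPts f))ᶜ := by
  obtain ⟨ψ, hψΨ, τ, hτ, rfl⟩ := hcover x hxV
  have hψ := hchart ψ hψΨ
  have hfD := mapsTo_closure_periodicPts hf
  have hinj := injective_iterate_of_mem_recurrentPts hf hx hxP
  have hτ01 : Icc (0 : ℝ) 1 ∈ 𝓝 τ := Icc_mem_nhds hτ.1 hτ.2
  have hret : ∀ U ∈ 𝓝 τ, ∀ N, ∃ n ≥ N, ∃ w ∈ U, w ≠ τ ∧ f^[n] (ψ τ) = ψ w := by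
    intro U hU N
    obtain ⟨ε, hε, hεU⟩ := Metric.mem_nhds_iff.1 (inter_mem hU hτ01)
    rw [Real.ball_eq_Ioo] at hεU
    have hεI := closure_mono (hεU.trans inter_subset_right)
    rw [closure_Ioo (by linarith), isClosed_Icc.closure_eq] at hεI
    have h₀ := (hεI ⟨le_rfl, by linarith⟩).1
    have h₁ := (hεI ⟨by linarith, le_rfl⟩).2
    obtain ⟨n, hn, w, hw, hnw⟩ := exists_iterate_mem_of_mem_recurrentPts hx
      ((hψ.isOpen_image_Ioo h₀ h₁).mem_nhds ⟨τ, ⟨by linarith, by linarith⟩, rfl⟩) (N + 1)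
    refine ⟨n, by omega, w, (hεU hw).1, ?_, hnw.symm⟩
    rintro rfl
    have : n = 0 := hinj hnw.symm
    omega
  have hpre : Icc 0 1 ∩ ψ ⁻¹' (closure (periodicPts f))ᶜ ∈ 𝓝 τ :=
    inter_mem hτ01 ((hψ.continuousOn.continuousAt hτ01).preimage_mem_nhds
      (isClosed_closure.isOpen_compl.mem_nhds hxP))
  obtain ⟨ε, hε, hεI⟩ := Metric.nhds_basis_closedBall.mem_iff.1 hpre
  rw [Real.closedBall_eq_Icc] at hεI
  have hinterval : ∀ η, 0 < η → η ≤ ε → 0 ≤ τ - η ∧ τ + η ≤ 1 ∧ τ ∈ Ioo (τ - η) (τ + η) ∧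
      ψ '' Icc (τ - η) (τ + η) ⊆ (closure (periodicPts f))ᶜ := by
    intro η hη hηε
    have hsub : Icc (τ - η) (τ + η) ⊆ Icc (τ - ε) (τ + ε) :=
      Icc_subset_Icc (by linarith) (by linarith)
    refine ⟨(hεI (hsub ⟨le_rfl, by linarith⟩)).1.1, (hεI (hsub ⟨by linarith, le_rfl⟩)).1.2,
      ⟨by linarith, by linarith⟩, ?_⟩
    rintro _ ⟨t, ht, rfl⟩
    exact (hεI (hsub ht)).2
  by_cases hE : ∀ δ > 0, ∃ s ∈ Icc (τ - ε) (τ + ε), |s - τ| < δ ∧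
      ∃ n, f^[n] (ψ s) ∈ closure (periodicPts f)
  · obtain ⟨hα, hβ, hmem, hJ⟩ := hinterval ε hε le_rfl
    exact (hψ.false_of_returns hf hfD subset_closure hα hβ hJ hmem hE hret).elim
  push Not at hE
  obtain ⟨δ, hδ, hnot⟩ := hE
  set η := min ε (δ / 2) with hη
  have hηε : η ≤ ε := min_le_left _ _
  have hηδ : η < δ := (min_le_right _ _).trans_lt (half_lt_self hδ)
  obtain ⟨hα, hβ, hmem, hJ⟩ := hinterval η (lt_min hε (half_pos hδ)) hηε
  rcases exists_isCircle_or_coordinate hV hΨ hchart hcover hψ isClosed_closure hα hβ hmem hJ with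
    hC | ⟨h, hhc, hht, -, hhψ⟩
  · exact hC
  exfalso
  have hmaps : ∀ k, ∀ t ∈ Icc (τ - η) (τ + η), f^[k] (ψ t) ∈ (closure (periodicPts f))ᶜ := by
    intro k t ht
    refine hnot t ⟨by linarith [ht.1], by linarith [ht.2]⟩ ?_ k
    rw [abs_lt]
    constructor <;> linarith [ht.1, ht.2]
  have hsub : Icc (τ - η) (τ + η) ⊆ Icc 0 1 := Icc_subset_Icc hα hβ
  obtain ⟨k, hk, t, ht, hkt⟩ := exists_apply_eq_of_returns (F := fun k t ↦ h (f^[k] (ψ t)))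
    (fun k ↦ hhc.comp ((hf.iterate k).comp_continuousOn (hψ.continuousOn.mono hsub)) (hmaps k))
    (fun k l t _ hkt ↦ by
      rw [hhψ _ hkt, ← iterate_add_apply, add_comm]) hmem
    (fun U hU N ↦ by
      obtain ⟨n, hn, w, hw, -, hnw⟩ := hret _ (inter_mem hU (Icc_mem_nhds hmem.1 hmem.2)) N
      refine ⟨n, hn, ?_⟩
      rw [hnw, hht w hw.2]
      exact hw.1)
  have hper := hhψ (f^[k] (ψ t)) (hkt.symm ▸ ht)
  rw [hkt] at hper
  exact hJ ⟨t, Ioo_subset_Icc_self ht, rfl⟩ (subset_closure ⟨k, hk, hper.symm⟩)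

theorem IsTopGraph.exists_isCircle_of_mem_closure_recurrentPts (hG : IsTopGraph V)
    (hf : Continuous f) {z : G} (hz : z ∈ closure (recurrentPts f))
    (hzP : z ∉ closure (periodicPts f)) :
    ∃ C, IsCircle C ∧ z ∈ C ∧ C ⊆ (closure (periodicPts f))ᶜ := by
  obtain ⟨Ψ, hΨ, hchart, hcover⟩ := hG.exists_finite_edgeCharts
  set T := recurrentPts f \ (closure (periodicPts f) ∪ V) with hT
  have hTsub : T ⊆ ⋃ ψ ∈ Ψ, T ∩ ψ '' Ioo 0 1 := by
    intro t ht
    obtain ⟨ψ, hψ, htψ⟩ := hcover t fun h ↦ ht.2 (Or.inr h)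
    exact mem_biUnion hψ ⟨ht, htψ⟩
  have hzT := closure_mono hTsub
    (mem_closure_recurrentPts_diff hf hG.finite_vertexSet hz hzP)
  rw [hΨ.closure_biUnion] at hzT
  simp only [mem_iUnion] at hzT
  obtain ⟨ψ, hψ, hzψ⟩ := hzT
  obtain ⟨_, ht, s, hs, rfl⟩ := closure_nonempty_iff.1 ⟨z, hzψ⟩
  obtain ⟨C, hC, htC, hCP⟩ := exists_isCircle_of_mem_recurrentPts hG.finite_vertexSet hΨ hchart
    hcover hf ht.1 (fun h ↦ ht.2 (Or.inl h)) fun h ↦ ht.2 (Or.inr h)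
  have hCV : (C ∩ V).Nonempty := by
    refine nonempty_of_ncard_ne_zero fun h ↦ ?_
    have := hG.circle_vertices C hC
    omega
  refine ⟨C, hC, ?_, hCP⟩
  refine closure_minimal ?_ hC.isCompact.isClosed hzψ
  exact inter_subset_right.trans ((image_mono Ioo_subset_Icc_self).trans
    ((hchart ψ hψ).image_subset_circle hC hCV hs htC))

end CirclesThroughRecurrentPoints

/-- a subset `W` of `G − cl(P(f))` meeting no circle of `G − cl(P(f))`
misses `cl(R(f))`; in particular for components of `G − cl(P(f))` containing no circle,
and if `G − cl(P(f))` contains no circle at all then `cl(R(f)) = cl(P(f))`. -/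
theorem recurrent_avoids_circle_free_sets {G : Type*} [MetricSpace G] (V : Set G)
    (hG : IsTopGraph V) (f : G → G) (hf : Continuous f) :
    (∀ W : Set G, W ⊆ (closure (Function.periodicPts f))ᶜ →
      (∀ C : Set G, IsCircle C → C ⊆ (closure (Function.periodicPts f))ᶜ → W ∩ C = ∅) →
      W ∩ closure (recurrentPts f) = ∅) ∧
    (∀ W : Set G, IsCompOf W (closure (Function.periodicPts f))ᶜ →
      (∀ C : Set G, IsCircle C → ¬C ⊆ W) →
      W ∩ closure (recurrentPts f) = ∅) ∧
    ((∀ C : Set G, IsCircle C → ¬C ⊆ (closure (Function.periodicPts f))ᶜ) →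
      closure (recurrentPts f) = closure (Function.periodicPts f)) := by
  have hfirst : ∀ W : Set G, W ⊆ (closure (Function.periodicPts f))ᶜ →
      (∀ C : Set G, IsCircle C → C ⊆ (closure (Function.periodicPts f))ᶜ → W ∩ C = ∅) →
      W ∩ closure (recurrentPts f) = ∅ := by
    intro W hW hWC
    rw [eq_empty_iff_forall_notMem]
    rintro z ⟨hzW, hzR⟩
    obtain ⟨C, hC, hzC, hCP⟩ := hG.exists_isCircle_of_mem_closure_recurrentPts hf hzR (hW hzW)
    exact notMem_empty z (hWC C hC hCP ▸ ⟨hzW, hzC⟩)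
  refine ⟨hfirst, ?_, fun hno ↦ Subset.antisymm ?_ (closure_mono periodicPts_subset_recurrentPts)⟩
  · rintro _ ⟨x, -, rfl⟩ hno
    refine hfirst _ (connectedComponentIn_subset _ _) fun C hC hCP ↦ ?_
    rw [eq_empty_iff_forall_notMem]
    rintro z ⟨hzW, hzC⟩
    refine hno C hC ?_
    rw [connectedComponentIn_eq hzW]
    exact hC.isPreconnected.subset_connectedComponentIn hzC hCP
  · have h := hfirst _ Subset.rfl fun C hC hCP ↦ absurd hCP (hno C hC)
    exact disjoint_compl_left_iff_subset.1 (disjoint_iff_inter_eq_empty.2 h)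
end
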